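/- arXiv:0706.2484 — 3 statements merged into one kernel-verified Lean document; each statement's English description precedes it below -/
import Mathlib

section
/- For every integer n ≥ 2, let p_n : [−n,n] → [−n,n] be the continuous odd map (p_n(−x) = −p_n(x)) with p_n(0) = 0, p_n(i) = i+1 for every integer 1 ≤ i ≤ n−1, p_n(n) = −1, and p_n affine on each interval [j,j+1] for integers −n ≤ j ≤ n−1. Then for every positive integer k, the set {x ∈ [−n,n] : p_n^k(x) = x} is finite and has exactly a_{2n,k} elements. -/
/-- `f` is affine (linear interpolation between its endpoint values) on `[a, b]`. -/
def AffOn (f : ℝ → ℝ) (a b : ℝ) : Prop :=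
  ∀ x ∈ Set.Icc a b, f x = f a + (x - a) * (f b - f a) / (b - a)

/-- Number of length-`k` walks from the `i`-th positive lap `(i, i + 1]` to the `j`-th lap of sign
`ε` in the Markov graph of the odd map, up to a global change of sign. -/
def lapWalks (n j : ℕ) : ℕ → ℕ → ℤˣ → ℕ
  | 0, i, ε => if i = j ∧ ε = 1 then 1 else 0
  | k + 1, i, ε =>
      if i = 0 then lapWalks n j k 0 ε + lapWalks n j k 1 ε
      else if i + 1 < n then lapWalks n j k (i + 1) ε
      else ∑ l ∈ Finset.range n, lapWalks n j k l ε + lapWalks n j k 0 (-ε)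

section LapWalks

variable {n j : ℕ}

theorem lapWalks_succ_zero (k : ℕ) (ε : ℤˣ) :
    lapWalks n j (k + 1) 0 ε = lapWalks n j k 0 ε + lapWalks n j k 1 ε := by
  simp [lapWalks]

theorem lapWalks_succ_mid (k : ℕ) {i : ℕ} (hi : i ≠ 0) (hin : i + 1 < n) (ε : ℤˣ) :
    lapWalks n j (k + 1) i ε = lapWalks n j k (i + 1) ε := by
  simp [lapWalks, hi, hin]

theorem lapWalks_succ_last (k : ℕ) {i : ℕ} (hi : i ≠ 0) (hin : i + 1 = n) (ε : ℤˣ) :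
    lapWalks n j (k + 1) i ε =
      ∑ l ∈ Finset.range n, lapWalks n j k l ε + lapWalks n j k 0 (-ε) := by
  simp [lapWalks, hi, hin]

theorem lapWalks_add_eq (i : ℕ) : ∀ (k : ℕ) (_ : i + 1 < n) (ε : ℤˣ),
    lapWalks n j k (i + 1) ε + lapWalks n j (k + i) 0 ε = lapWalks n j (k + i + 1) 0 ε := by
  induction i with
  | zero => intro k _ ε; simp [lapWalks_succ_zero, add_comm]
  | succ i ih =>
    intro k hi ε
    rw [← lapWalks_succ_mid k (Nat.succ_ne_zero i) hi, ← add_assoc, add_right_comm k i 1]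
    exact ih (k + 1) (by omega) ε

theorem sum_range_lapWalks (k m : ℕ) (hm : m + 1 ≤ n) (ε : ℤˣ) :
    ∑ l ∈ Finset.range (m + 1), lapWalks n j k l ε = lapWalks n j (k + m) 0 ε := by
  induction m with
  | zero => simp
  | succ m ih =>
    rw [Finset.sum_range_succ, ih (by omega), add_comm, lapWalks_add_eq m k (by omega), add_assoc]

theorem lapWalks_zero_rec (hn : 2 ≤ n) (k : ℕ) (ε : ℤˣ) :
    lapWalks n j (k + n) 0 ε = 2 * lapWalks n j (k + n - 1) 0 ε + lapWalks n j k 0 (-ε) := by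
  obtain ⟨m, rfl⟩ : ∃ m, n = m + 2 := ⟨n - 2, by omega⟩
  have h1 := lapWalks_add_eq (n := m + 2) (j := j) m (k + 1) (by omega) ε
  have h2 := lapWalks_succ_last (n := m + 2) (j := j) (i := m + 1) k m.succ_ne_zero rfl ε
  have h3 : ∑ l ∈ Finset.range (m + 2), lapWalks (m + 2) j k l ε =
      lapWalks (m + 2) j (k + (m + 1)) 0 ε :=
    sum_range_lapWalks k (m + 1) le_rfl ε
  have e1 : k + 1 + m = k + m + 1 := by ring
  have e2 : k + 1 + m + 1 = k + (m + 2) := by ring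
  have e3 : k + (m + 2) - 1 = k + m + 1 := by omega
  have e4 : k + (m + 1) = k + m + 1 := by ring
  rw [e2, e1] at h1
  rw [e4] at h3
  rw [e3]
  omega

theorem lapWalks_rec (hn : 2 ≤ n) (k : ℕ) {i : ℕ} (hi : i < n) (ε : ℤˣ) :
    lapWalks n j (k + n) i ε = 2 * lapWalks n j (k + n - 1) i ε + lapWalks n j k i (-ε) := by
  rcases i with _ | i
  · exact lapWalks_zero_rec hn k ε
  have h1 := lapWalks_add_eq (j := j) i (k + n) hi ε
  have h2 := lapWalks_add_eq (j := j) i (k + n - 1) hi ε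
  have h3 := lapWalks_add_eq (j := j) i k hi (-ε)
  have h4 := lapWalks_zero_rec (j := j) hn (k + i) ε
  have h5 := lapWalks_zero_rec (j := j) hn (k + i + 1) ε
  have e1 : k + i + n = k + n + i := by ring
  have e2 : k + n + i - 1 = k + n - 1 + i := by omega
  have e3 : k + i + 1 + n = k + n + i + 1 := by ring
  have e4 : k + n + i + 1 - 1 = k + n - 1 + i + 1 := by omega
  have e5 : k + n - 1 + i + 1 = k + n + i := by omega
  rw [e1, e2] at h4
  rw [e3, e4] at h5
  rw [e5] at h2 h5
  omega

theorem lapWalks_short (m : ℕ) : ∀ i, i ≠ 0 → i + m < n → ∀ ε : ℤˣ,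
    lapWalks n j m i ε = if i + m = j ∧ ε = 1 then 1 else 0 := by
  induction m with
  | zero => intro i _ _ ε; simp [lapWalks]
  | succ m ih =>
    intro i hi him ε
    rw [lapWalks_succ_mid m hi (by omega), ih (i + 1) (by omega) (by omega)]
    simp [add_comm, add_left_comm]

theorem lapWalks_zero_short (m : ℕ) (hm : m < n) (ε : ℤˣ) :
    lapWalks n j m 0 ε = if j ≤ m ∧ ε = 1 then 1 else 0 := by
  induction m with
  | zero => simp [lapWalks, eq_comm]
  | succ m ih =>
    rw [lapWalks_succ_zero, ih (by omega), lapWalks_short m 1 one_ne_zero (by omega)]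
    by_cases h : ε = 1
    · simp only [h, and_true]
      split_ifs <;> omega
    · simp [h]

theorem lapWalks_zero_one (hn : 2 ≤ n) (hj : j < n) (m : ℕ) (hjm : j ≤ m) (hm : m < 2 * n) :
    lapWalks n j m 0 1 = 2 ^ (m + 1 - n) := by
  induction m with
  | zero => rw [lapWalks_zero_short 0 (by omega)]; simp [hjm, show 1 - n = 0 by omega]
  | succ m ih =>
    by_cases h : m + 1 < n
    · rw [lapWalks_zero_short _ h]; simp [hjm, show m + 1 + 1 - n = 0 by omega]
    · have := lapWalks_zero_rec (j := j) hn (m + 1 - n) 1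
      rw [lapWalks_zero_short (m + 1 - n) (by omega), show m + 1 - n + n = m + 1 by omega,
        Nat.add_sub_cancel, ih (by omega) (by omega)] at this
      rw [this, show m + 1 + 1 - n = m + 1 - n + 1 by omega, pow_succ]
      simp [mul_comm]

theorem lapWalks_zero_neg_one (hn : 2 ≤ n) (hj : j < n) (m : ℕ) (hm : m < n + j) :
    lapWalks n j m 0 (-1) = 0 := by
  induction m with
  | zero => rw [lapWalks_zero_short 0 (by omega)]; simp
  | succ m ih =>
    by_cases h : m + 1 < n
    · rw [lapWalks_zero_short _ h]; simp
    · have := lapWalks_zero_rec (j := j) hn (m + 1 - n) (-1)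
      rw [lapWalks_zero_short (m + 1 - n) (by omega), show m + 1 - n + n = m + 1 by omega,
        Nat.add_sub_cancel, ih (by omega)] at this
      rw [this, if_neg (by omega)]

/-- Number of closed walks of length `k` with total sign `ε`. -/
def closedLapWalks (n k : ℕ) (ε : ℤˣ) : ℕ := ∑ j ∈ Finset.range n, lapWalks n j k j ε

theorem closedLapWalks_rec (hn : 2 ≤ n) (k : ℕ) (ε : ℤˣ) :
    closedLapWalks n (k + n) ε = 2 * closedLapWalks n (k + n - 1) ε + closedLapWalks n k (-ε) := by
  simp only [closedLapWalks, Finset.mul_sum, ← Finset.sum_add_distrib]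
  exact Finset.sum_congr rfl fun j hj => lapWalks_rec hn k (Finset.mem_range.1 hj) ε

theorem closedLapWalks_length_zero : closedLapWalks n 0 1 = n := by
  simp [closedLapWalks, lapWalks]

theorem closedLapWalks_neg_one (hn : 2 ≤ n) (k : ℕ) (hk : k < n) :
    closedLapWalks n k (-1) = 0 := by
  refine Finset.sum_eq_zero fun j hj => ?_
  have hj := Finset.mem_range.1 hj
  rcases j with _ | j
  · exact lapWalks_zero_neg_one hn hj k (by omega)
  · have := lapWalks_add_eq (j := j + 1) j k hj (-1)
    rw [lapWalks_zero_neg_one hn hj (k + j + 1) (by omega)] at this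
    omega

theorem closedLapWalks_one_of_lt (hn : 2 ≤ n) (k : ℕ) (hk0 : 0 < k) (hk : k < n) :
    closedLapWalks n k 1 = 2 ^ k := by
  have key : ∀ m, m + 1 ≤ n →
      ∑ j ∈ Finset.range (m + 1), lapWalks n j k j 1 = 2 ^ (k + (m + 1) - n) := by
    intro m
    induction m with
    | zero =>
      intro _
      simp [lapWalks_zero_one hn (show 0 < n by omega) k (by omega) (by omega)]
    | succ m ih =>
      intro hm
      rw [Finset.sum_range_succ, ih (by omega)]
      have := lapWalks_add_eq (n := n) (j := m + 1) m k (by omega) 1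
      rw [lapWalks_zero_one hn (by omega) (k + m) (by omega) (by omega),
        lapWalks_zero_one hn (by omega) (k + m + 1) (by omega) (by omega)] at this
      have e1 : k + (m + 1) - n = k + m + 1 - n := by omega
      have e2 : k + (m + 1 + 1) - n = k + m + 1 + 1 - n := by omega
      rw [e1, e2]
      omega
  have := key (n - 1) (by omega)
  rwa [show n - 1 + 1 = n by omega, Nat.add_sub_cancel] at this

theorem closedLapWalks_one (hn : 2 ≤ n) (k : ℕ) (hk0 : 0 < k) (hk : k < 2 * n) :
    closedLapWalks n k 1 = 2 ^ k := by
  induction k with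
  | zero => omega
  | succ k ih =>
    by_cases h : k + 1 < n
    · exact closedLapWalks_one_of_lt hn _ hk0 h
    · have := closedLapWalks_rec hn (k + 1 - n) 1
      rw [closedLapWalks_neg_one hn _ (by omega), show k + 1 - n + n = k + 1 by omega,
        Nat.add_sub_cancel, ih (by omega) (by omega)] at this
      rw [this, pow_succ]; ring

theorem closedLapWalks_one_rec (hn : 2 ≤ n) (k : ℕ) :
    closedLapWalks n (k + 2 * n) 1 + 4 * closedLapWalks n (k + 2 * n - 2) 1 =
      4 * closedLapWalks n (k + 2 * n - 1) 1 + closedLapWalks n k 1 := by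
  have h1 := closedLapWalks_rec hn (k + n) 1
  have h2 := closedLapWalks_rec hn (k + n - 1) 1
  have h3 := closedLapWalks_rec hn k (-1)
  rw [neg_neg] at h3
  rw [show k + n + n = k + 2 * n by ring] at h1
  rw [show k + n - 1 + n = k + 2 * n - 1 by omega,
    show k + 2 * n - 1 - 1 = k + 2 * n - 2 by omega] at h2
  omega

theorem sum_range_pow_two_sub_one (m : ℕ) :
    ∑ i ∈ Finset.range m, ((2 : ℤ) ^ (i + 2) - 1) = 2 ^ (m + 2) - 4 - m := by
  induction m with
  | zero => norm_num
  | succ m ih => rw [Finset.sum_range_succ, ih]; push_cast; ring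

theorem eq_closedLapWalks (hn : 2 ≤ n) (a : ℕ → ℤ)
    (haLow : ∀ k : ℕ, 1 ≤ k → k ≤ 2 * n - 1 → a k = 2 ^ (k + 1) - 1)
    (haRec : ∀ k : ℕ, 2 * n ≤ k →
      a k = 3 * a (k - 1) - ∑ i ∈ Finset.Icc 2 (2 * n - 1), a (k - i))
    (k : ℕ) (hk : 0 < k) : a k = 2 * closedLapWalks n k 1 - 1 := by
  have hsum : ∀ k, 2 * n ≤ k → ∑ i ∈ Finset.Icc 2 (2 * n - 1), a (k - i) =
      ∑ i ∈ Finset.range (2 * n - 2), a (k - 2 * n + 1 + i) := by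
    intro k hk
    refine Finset.sum_nbij' (fun i => 2 * n - 1 - i) (fun i => 2 * n - 1 - i) ?_ ?_ ?_ ?_ ?_
    all_goals intro i hi
    all_goals simp only [Finset.mem_Icc, Finset.mem_range] at *
    any_goals omega
    congr 1; omega
  have hfirst : a (2 * n) = 2 ^ (2 * n + 1) + 2 * n - 1 := by
    rw [haRec _ le_rfl, hsum _ le_rfl, haLow (2 * n - 1) (by omega) le_rfl]
    rw [Finset.sum_congr rfl (g := fun i => (2 : ℤ) ^ (i + 2) - 1), sum_range_pow_two_sub_one]
    · have e1 : 2 * n - 2 + 2 = 2 * n := by omega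
      have e2 : 2 * n - 1 + 1 = 2 * n := by omega
      rw [e1, e2]
      push_cast [show 2 ≤ 2 * n by omega]
      ring
    · intro i hi
      rw [Finset.mem_range] at hi
      rw [haLow _ (by omega) (by omega)]
      congr 2; omega
  have hrec : ∀ m, a (m + 1 + 2 * n) = 4 * a (m + 2 * n) - 4 * a (m + 2 * n - 1) + a (m + 1) := by
    intro m
    have h1 := haRec (m + 1 + 2 * n) (by omega)
    have h2 := haRec (m + 2 * n) (by omega)
    rw [hsum _ (by omega)] at h1 h2
    rw [show m + 1 + 2 * n - 1 = m + 2 * n by omega, Nat.add_sub_cancel] at h1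
    rw [Nat.add_sub_cancel] at h2
    obtain ⟨q, hq⟩ : ∃ q, 2 * n - 2 = q + 1 := ⟨2 * n - 3, by omega⟩
    rw [hq, Finset.sum_range_succ] at h1
    rw [hq, Finset.sum_range_succ'] at h2
    have e : ∑ i ∈ Finset.range q, a (m + 1 + 1 + i) = ∑ i ∈ Finset.range q, a (m + 1 + (i + 1)) :=
      Finset.sum_congr rfl fun i _ => by congr 1; ring
    rw [e, show m + 1 + 1 + q = m + 2 * n - 1 by omega] at h1
    rw [add_zero] at h2
    linarith
  induction k using Nat.strong_induction_on with
  | _ k ih =>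
    by_cases h1 : k < 2 * n
    · rw [haLow k hk (by omega), closedLapWalks_one hn k hk h1, pow_succ]; push_cast; ring
    obtain ⟨m, rfl⟩ : ∃ m, k = m + 2 * n := ⟨k - 2 * n, by omega⟩
    have hc := closedLapWalks_one_rec hn m
    rcases m with _ | m
    · rw [closedLapWalks_length_zero, closedLapWalks_one hn (0 + 2 * n - 1) (by omega) (by omega),
        closedLapWalks_one hn (0 + 2 * n - 2) (by omega) (by omega)] at hc
      rw [zero_add] at hc ⊢
      rw [hfirst]
      obtain ⟨q, hq⟩ : ∃ q, 2 * n = q + 2 := ⟨2 * n - 2, by omega⟩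
      rw [show 2 * n - 1 = q + 1 by omega, show 2 * n - 2 = q by omega] at hc
      zify at hc
      rw [show 2 * n + 1 = q + 3 by omega]
      linear_combination (-2) * hc
    · rw [hrec m, ih (m + 2 * n) (by omega) (by omega),
        ih (m + 2 * n - 1) (by omega) (by omega), ih (m + 1) (by omega) (by omega)]
      rw [show m + 1 + 2 * n - 2 = m + 2 * n - 1 by omega,
        show m + 1 + 2 * n - 1 = m + 2 * n by omega] at hc
      zify at hc
      linear_combination (-2) * hc

end LapWalks

/-- The odd piecewise affine map `p_n` on `[-n, n]`, described on its positive laps. -/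
structure IsOddLapMap (n : ℕ) (p : ℝ → ℝ) : Prop where
  two_le : 2 ≤ n
  mapsTo : Set.MapsTo p (Set.Icc (-(n : ℝ)) (n : ℝ)) (Set.Icc (-(n : ℝ)) (n : ℝ))
  odd : ∀ x ∈ Set.Icc (-(n : ℝ)) (n : ℝ), p (-x) = - p x
  zero : p 0 = 0
  first : ∀ x : ℝ, 0 ≤ x → x ≤ 1 → p x = 2 * x
  mid : ∀ x : ℝ, 1 ≤ x → x + 1 ≤ n → p x = x + 1
  last : ∀ x : ℝ, (n : ℝ) ≤ x + 1 → x ≤ n → p x = n - (n + 1) * (x - (n - 1))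

/-- The points of the positive lap `(i, i + 1]` that `p^k` sends to `ε z` with `z ∈ (j, j + 1]`
and that are recovered from `z` by the affine map `z ↦ α z + β`. -/
def returnSet (p : ℝ → ℝ) (j k i : ℕ) (ε : ℤˣ) (α β : ℝ) : Set ℝ :=
  {x | ((i : ℝ) < x ∧ x ≤ i + 1) ∧
    ∃ z : ℝ, ((j : ℝ) < z ∧ z ≤ j + 1) ∧ p^[k] x = ((ε : ℤ) : ℝ) * z ∧ α * z + β = x}

/-- The affine map `z ↦ α z + β` reverses orientation and maps the lap `(j, j + 1]` over
`[i, i + 1]`, with strict overlap at `i`. -/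
def ReversedCover (j i : ℕ) (α β : ℝ) : Prop :=
  (i : ℝ) + 1 ≤ α * j + β ∧ α * (j + 1) + β < i

/-- The affine map `z ↦ α z + β` maps the lap `(j, j + 1]` over `[i, i + 1]`. -/
def Cover (j i : ℕ) (α β : ℝ) : Prop :=
  (α * j + β ≤ i ∧ (i : ℝ) + 1 ≤ α * (j + 1) + β) ∨ ReversedCover j i α β

/-- The affine map `z ↦ α z + β` maps the lap `(j, j + 1]` over `[i, i + 1]`, with strict overlap
at `i`. -/
def StrictCover (j i : ℕ) (α β : ℝ) : Prop :=
  (α * j + β < i ∧ (i : ℝ) + 1 ≤ α * (j + 1) + β) ∨ ReversedCover j i α β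

theorem StrictCover.cover {j i : ℕ} {α β : ℝ} (h : StrictCover j i α β) : Cover j i α β :=
  h.imp (fun h => ⟨h.1.le, h.2⟩) id

theorem encard_setOf_lt_le_eq_sum (S : Set ℝ) (u : ℝ → ℝ) (m : ℕ) :
    {x ∈ S | 0 < u x ∧ u x ≤ m}.encard =
      ∑ l ∈ Finset.range m, {x ∈ S | (l : ℝ) < u x ∧ u x ≤ l + 1}.encard := by
  induction m with
  | zero =>
    rw [Finset.range_zero, Finset.sum_empty, Set.encard_eq_zero]
    ext x
    simp only [Set.mem_ofPred_eq, Set.mem_empty_iff_false, iff_false, Nat.cast_zero]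
    rintro ⟨_, h1, h2⟩
    linarith
  | succ m ih =>
    rw [Finset.sum_range_succ, ← ih, ← Set.encard_union_eq]
    · congr 1
      ext x
      simp only [Set.mem_ofPred_eq, Set.mem_union, Nat.cast_succ]
      have : (0 : ℝ) ≤ m := m.cast_nonneg
      constructor
      · rintro ⟨h, h1, h2⟩
        rcases le_or_gt (u x) m with h3 | h3
        · exact Or.inl ⟨h, h1, h3⟩
        · exact Or.inr ⟨h, h3, h2⟩
      · rintro (⟨h, h1, h2⟩ | ⟨h, h1, h2⟩)
        · exact ⟨h, h1, by linarith⟩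
        · exact ⟨h, by linarith, h2⟩
    · rw [Set.disjoint_left]
      rintro x ⟨_, _, h1⟩ ⟨_, h2, _⟩
      linarith

theorem units_cast_mul_self (s : ℤˣ) : ((s : ℤ) : ℝ) * ((s : ℤ) : ℝ) = 1 := by
  rcases Int.units_eq_one_or s with rfl | rfl <;> norm_num

namespace IsOddLapMap

variable {n : ℕ} {p : ℝ → ℝ}

theorem iterate_neg (h : IsOddLapMap n p) (k : ℕ) :
    ∀ x ∈ Set.Icc (-(n : ℝ)) (n : ℝ), p^[k] (-x) = - p^[k] x := by
  induction k with
  | zero => intro x _; rfl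
  | succ k ih =>
    intro x hx
    rw [Function.iterate_succ_apply, Function.iterate_succ_apply, h.odd x hx, ih _ (h.mapsTo hx)]

theorem iterate_zero (h : IsOddLapMap n p) (k : ℕ) : p^[k] 0 = 0 :=
  Function.iterate_fixed h.zero k

theorem iterate_units_mul (h : IsOddLapMap n p) (k : ℕ) (s : ℤˣ) {x : ℝ}
    (hx : x ∈ Set.Icc (-(n : ℝ)) (n : ℝ)) :
    p^[k] (((s : ℤ) : ℝ) * x) = ((s : ℤ) : ℝ) * p^[k] x := by
  rcases Int.units_eq_one_or s with rfl | rfl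
  · simp
  · simpa using h.iterate_neg k x hx

theorem map_natCast (h : IsOddLapMap n p) (m : ℕ) (hm : m ≤ n) : ∃ y : ℤ, p m = y := by
  rcases Nat.eq_zero_or_pos m with rfl | h0
  · exact ⟨0, by simpa using h.zero⟩
  have h1 : (1 : ℝ) ≤ m := by exact_mod_cast h0
  rcases hm.eq_or_lt with rfl | hlt
  · exact ⟨-1, by rw [h.last m (by linarith) le_rfl]; push_cast; ring⟩
  · exact ⟨m + 1, by rw [h.mid m h1 (by exact_mod_cast hlt)]; push_cast; ring⟩

theorem map_intCast (h : IsOddLapMap n p) (m : ℤ) (hm : (m : ℝ) ∈ Set.Icc (-(n : ℝ)) (n : ℝ)) :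
    ∃ y : ℤ, p m = y := by
  have hn : m.natAbs ≤ n := by
    have h1 : -(n : ℤ) ≤ m := by exact_mod_cast hm.1
    have h2 : m ≤ (n : ℤ) := by exact_mod_cast hm.2
    omega
  obtain ⟨y, hy⟩ := h.map_natCast m.natAbs hn
  rcases Int.natAbs_eq m with e | e
  · exact ⟨y, by rw [e]; simpa using hy⟩
  · refine ⟨-y, ?_⟩
    have hmem : ((m.natAbs : ℕ) : ℝ) ∈ Set.Icc (-(n : ℝ)) (n : ℝ) :=
      ⟨by linarith [(n.cast_nonneg : (0 : ℝ) ≤ n), (m.natAbs.cast_nonneg : (0 : ℝ) ≤ m.natAbs)],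
        by exact_mod_cast hn⟩
    have e' : (m : ℝ) = -((m.natAbs : ℕ) : ℝ) := by exact_mod_cast e
    rw [e', h.odd _ hmem, hy]; push_cast; ring

theorem iterate_intCast (h : IsOddLapMap n p) (k : ℕ) :
    ∀ m : ℤ, (m : ℝ) ∈ Set.Icc (-(n : ℝ)) (n : ℝ) → ∃ y : ℤ, p^[k] m = y := by
  induction k with
  | zero => intro m _; exact ⟨m, rfl⟩
  | succ k ih =>
    intro m hm
    obtain ⟨y, hy⟩ := h.map_intCast m hm
    have := h.mapsTo hm
    rw [hy] at this
    obtain ⟨w, hw⟩ := ih y this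
    exact ⟨w, by rw [Function.iterate_succ_apply, hy, hw]⟩

/-- If `p` is `x ↦ a x + b` on a lap, the part of the return set sent to the `l`-th lap of sign `s`
is in bijection with a return set based at that lap. -/
theorem encard_returnSet_inter (h : IsOddLapMap n p) {j k i l : ℕ} (hl : l < n) (ε s : ℤˣ)
    {α β a b : ℝ} (ha : a ≠ 0)
    (hp : ∀ x : ℝ, (i : ℝ) ≤ x → x ≤ i + 1 → p x = a * x + b)
    (hcov : ∀ y z : ℝ, (l : ℝ) < y → y ≤ l + 1 → (j : ℝ) < z → z ≤ j + 1 →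
      p^[k] y = (((s * ε : ℤˣ) : ℤ) : ℝ) * z → a * (α * z + β) + b = ((s : ℤ) : ℝ) * y →
      (i : ℝ) < α * z + β ∧ α * z + β ≤ i + 1) :
    {x ∈ returnSet p j (k + 1) i ε α β |
        (l : ℝ) < ((s : ℤ) : ℝ) * p x ∧ ((s : ℤ) : ℝ) * p x ≤ l + 1}.encard =
      (returnSet p j k l (s * ε) (((s : ℤ) : ℝ) * (a * α))
        (((s : ℤ) : ℝ) * (a * β + b))).encard := by
  have hs := units_cast_mul_self s
  set σ : ℝ := ((s : ℤ) : ℝ) with hσ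
  have hσ0 : σ ≠ 0 := fun h0 => by simp [h0] at hs
  have hmemn : ∀ y : ℝ, (l : ℝ) < y → y ≤ l + 1 → y ∈ Set.Icc (-(n : ℝ)) (n : ℝ) := by
    intro y h1 h2
    have : (l : ℝ) + 1 ≤ n := by exact_mod_cast hl
    have h3 : (0 : ℝ) ≤ l := l.cast_nonneg
    constructor <;> linarith
  have hinj : Set.InjOn (fun x : ℝ => σ * (a * x + b)) {x ∈ returnSet p j (k + 1) i ε α β |
        (l : ℝ) < σ * p x ∧ σ * p x ≤ l + 1} := by
    intro x _ y _ hxy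
    have := mul_left_cancel₀ hσ0 hxy
    exact mul_left_cancel₀ ha (by linarith)
  rw [← hinj.encard_image]
  congr 1
  ext y
  simp only [Set.mem_image, Set.mem_ofPred_eq, returnSet, Units.val_mul, Int.cast_mul, ← hσ]
  constructor
  · rintro ⟨x, ⟨⟨⟨hx1, hx2⟩, z, hz, hpz, hLz⟩, hl1, hl2⟩, rfl⟩
    rw [hp x hx1.le hx2] at hl1 hl2
    refine ⟨⟨hl1, hl2⟩, z, hz, ?_, by rw [← hLz]; ring⟩
    have e : p x = σ * (σ * (a * x + b)) := by rw [hp x hx1.le hx2, ← mul_assoc, hs, one_mul]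
    rw [Function.iterate_succ_apply, e, h.iterate_units_mul k s (hmemn _ hl1 hl2), ← hσ] at hpz
    rw [mul_assoc, ← hpz, ← mul_assoc, hs, one_mul]
  · rintro ⟨⟨hy1, hy2⟩, z, hz, hpz, hLz⟩
    have e : a * (α * z + β) + b = σ * y := by
      rw [← hLz]
      linear_combination (-(a * (α * z + β) + b)) * hs
    obtain ⟨hx1, hx2⟩ := hcov y z hy1 hy2 hz.1 hz.2 (by push_cast; exact hpz) e
    have e2 : σ * p (α * z + β) = y := by rw [hp _ hx1.le hx2, e, ← mul_assoc, hs, one_mul]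
    refine ⟨α * z + β, ⟨⟨⟨hx1, hx2⟩, z, hz, ?_, rfl⟩, ?_, ?_⟩, ?_⟩
    · rw [Function.iterate_succ_apply, hp _ hx1.le hx2, e, hσ, h.iterate_units_mul k s
        (hmemn y hy1 hy2), hpz, ← hσ, mul_assoc, ← mul_assoc, hs, one_mul]
    · rwa [e2]
    · rwa [e2]
    · rw [e, ← mul_assoc, hs, one_mul]

theorem encard_returnSet_succ_zero (h : IsOddLapMap n p) {j k : ℕ} (ε : ℤˣ) (α β : ℝ) :
    (returnSet p j (k + 1) 0 ε α β).encard =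
      (returnSet p j k 0 ε (2 * α) (2 * β)).encard +
        (returnSet p j k 1 ε (2 * α) (2 * β)).encard := by
  have hn := h.two_le
  have hp : ∀ x : ℝ, ((0 : ℕ) : ℝ) ≤ x → x ≤ (0 : ℕ) + 1 → p x = 2 * x + 0 := by
    intro x h1 h2
    rw [h.first x (by simpa using h1) (by simpa using h2), add_zero]
  have hall : returnSet p j (k + 1) 0 ε α β =
      {x ∈ returnSet p j (k + 1) 0 ε α β | 0 < p x ∧ p x ≤ (2 : ℕ)} := by
    ext x
    simp only [Set.mem_ofPred_eq]
    refine ⟨fun hx => ⟨hx, ?_⟩, fun hx => hx.1⟩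
    have h1 := hx.1.1
    have h2 := hx.1.2
    rw [hp x h1.le h2]
    push_cast at h1 h2 ⊢
    constructor <;> linarith
  have key : ∀ l : ℕ, l < 2 → {x ∈ returnSet p j (k + 1) 0 ε α β |
      (l : ℝ) < p x ∧ p x ≤ l + 1}.encard = (returnSet p j k l ε (2 * α) (2 * β)).encard := by
    intro l hl
    have hl' : (l : ℝ) + 1 ≤ 2 := by exact_mod_cast hl
    have hl0 : (0 : ℝ) ≤ l := l.cast_nonneg
    have := h.encard_returnSet_inter (j := j) (k := k) (l := l) (by omega) ε 1 (α := α) (β := β)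
      two_ne_zero hp ?_
    · simpa using this
    · intro y z h1 h2 _ _ _ e
      push_cast at e ⊢
      constructor <;> linarith
  rw [hall, encard_setOf_lt_le_eq_sum, Finset.sum_range_succ, Finset.sum_range_one, key 0 (by omega),
    key 1 (by omega)]

theorem encard_returnSet_succ_mid (h : IsOddLapMap n p) {j k i : ℕ} (hi : i ≠ 0) (hin : i + 1 < n)
    (ε : ℤˣ) (α β : ℝ) :
    (returnSet p j (k + 1) i ε α β).encard = (returnSet p j k (i + 1) ε α (β + 1)).encard := by
  have hi1 : (1 : ℝ) ≤ i := by exact_mod_cast Nat.one_le_iff_ne_zero.2 hi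
  have hin' : (i : ℝ) + 1 + 1 ≤ n := by exact_mod_cast hin
  have hp : ∀ x : ℝ, (i : ℝ) ≤ x → x ≤ i + 1 → p x = 1 * x + 1 := by
    intro x h1 h2
    rw [h.mid x (by linarith) (by linarith), one_mul]
  have := h.encard_returnSet_inter (j := j) (k := k) (l := i + 1) hin ε 1 (α := α) (β := β)
      one_ne_zero hp ?_
  · simp only [Units.val_one, Int.cast_one, one_mul] at this
    rw [← this]
    congr 1
    ext x
    simp only [Set.mem_ofPred_eq]
    refine ⟨fun hx => ⟨hx, ?_⟩, fun hx => hx.1⟩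
    rw [hp x hx.1.1.le hx.1.2]
    push_cast
    constructor <;> linarith [hx.1.1, hx.1.2]
  · intro y z h1 h2 _ _ _ e
    push_cast at e h1 h2 ⊢
    constructor <;> linarith

theorem encard_returnSet_succ_last (h : IsOddLapMap n p) {j k i : ℕ} (hin : i + 1 = n)
    (ε : ℤˣ) (α β : ℝ) (hc : Cover j i α β) :
    (returnSet p j (k + 1) i ε α β).encard =
      ∑ l ∈ Finset.range n,
          (returnSet p j k l ε (-(n + 1) * α) (-(n + 1) * β + n * n + n - 1)).encard +
        (returnSet p j k 0 (-ε) ((n + 1) * α) ((n + 1) * β - n * n - n + 1)).encard := by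
  have hn2 := h.two_le
  have hn2' : (2 : ℝ) ≤ n := by exact_mod_cast hn2
  have hin' : (i : ℝ) + 1 = n := by exact_mod_cast hin
  have hp : ∀ x : ℝ, (i : ℝ) ≤ x → x ≤ i + 1 → p x = -(n + 1) * x + (n * n + n - 1) := by
    intro x h1 h2
    rw [h.last x (by linarith) (by linarith)]; ring
  have hne : (-(n + 1) : ℝ) ≠ 0 := by linarith
  have hsplit : returnSet p j (k + 1) i ε α β =
      {x ∈ returnSet p j (k + 1) i ε α β | 0 < p x ∧ p x ≤ n} ∪
      {x ∈ returnSet p j (k + 1) i ε α β | 0 < -p x ∧ -p x ≤ (1 : ℕ)} := by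
    ext x
    simp only [Set.mem_ofPred_eq, Set.mem_union]
    refine ⟨fun hx => ?_, fun hx => hx.elim And.left And.left⟩
    have hpx : p x ≠ 0 := by
      intro h0
      obtain ⟨z, hz, hpz, -⟩ := hx.2
      rw [Function.iterate_succ_apply, h0, h.iterate_zero] at hpz
      have hz0 : z = 0 := by
        have := congrArg (((ε : ℤ) : ℝ) * ·) hpz
        simpa [← mul_assoc, units_cast_mul_self] using this.symm
      have : (0 : ℝ) ≤ j := j.cast_nonneg
      linarith [hz.1]
    have e := hp x hx.1.1.le hx.1.2
    rcases hpx.lt_or_gt with h0 | h0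
    · refine Or.inr ⟨hx, by linarith, ?_⟩
      rw [e]; push_cast
      nlinarith [hx.1.2]
    · refine Or.inl ⟨hx, h0, ?_⟩
      rw [e]
      nlinarith [hx.1.1]
  have hpos : ∀ l ∈ Finset.range n, {x ∈ returnSet p j (k + 1) i ε α β |
      (l : ℝ) < p x ∧ p x ≤ l + 1}.encard =
      (returnSet p j k l ε (-(n + 1) * α) (-(n + 1) * β + n * n + n - 1)).encard := by
    intro l hl
    rw [Finset.mem_range] at hl
    have hl' : (l : ℝ) + 1 ≤ n := by exact_mod_cast hl
    have hl0 : (0 : ℝ) ≤ l := l.cast_nonneg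
    have := h.encard_returnSet_inter (j := j) (k := k) (l := l) hl ε 1 (α := α) (β := β) hne hp ?_
    · simp only [Units.val_one, Int.cast_one, one_mul] at this
      rw [this]
      congr 2; ring
    · intro y z h1 h2 hz1 hz2 hpz e
      push_cast at e
      have hlow : (i : ℝ) ≤ α * z + β := by nlinarith
      refine ⟨hlow.lt_of_ne fun heq => ?_, by nlinarith⟩
      have hy : y = n := by rw [← heq] at e; nlinarith
      have hmem : (((n : ℤ)) : ℝ) ∈ Set.Icc (-(n : ℝ)) (n : ℝ) := by
        push_cast; constructor <;> linarith
      obtain ⟨w, hw⟩ := h.iterate_intCast k n hmem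
      rw [hy] at hpz
      push_cast at hw hpz
      rw [hw] at hpz
      have hzw : z = ((ε * w : ℤ) : ℝ) := by
        push_cast
        rw [hpz]
        simp [← mul_assoc, units_cast_mul_self]
      rw [hzw] at hz1 hz2
      have h3 : (j : ℤ) < ε * w := by exact_mod_cast hz1
      have h4 : (ε * w : ℤ) ≤ j + 1 := by exact_mod_cast hz2
      have h5 : (ε * w : ℤ) = j + 1 := by omega
      have h6 : z = j + 1 := by rw [hzw, h5]; push_cast; ring
      rw [h6] at heq
      rcases hc with ⟨_, hc⟩ | ⟨_, hc⟩ <;> linarith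
  have hneg : {x ∈ returnSet p j (k + 1) i ε α β | 0 < -p x ∧ -p x ≤ (1 : ℕ)}.encard =
      (returnSet p j k 0 (-ε) ((n + 1) * α) ((n + 1) * β - n * n - n + 1)).encard := by
    have := h.encard_returnSet_inter (j := j) (k := k) (l := 0) (by omega) ε (-1) (α := α) (β := β)
      hne hp ?_
    · simp only [Units.val_neg, Units.val_one, Int.cast_neg, Int.cast_one, neg_mul, one_mul,
        Nat.cast_zero, zero_add, neg_neg] at this
      rw [Nat.cast_one, this]
      congr 2; ring
    · intro y z h1 h2 hz1 hz2 hpz e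
      push_cast at e h1 h2
      constructor <;> nlinarith
  conv_lhs => rw [hsplit]
  rw [Set.encard_union_eq, encard_setOf_lt_le_eq_sum, Finset.sum_congr rfl hpos, hneg]
  rw [Set.disjoint_left]
  rintro x ⟨_, h1, _⟩ ⟨_, h2, _⟩
  linarith

theorem strictCover_last (h : IsOddLapMap n p) {j i l : ℕ} (hin : i + 1 = n) (hl : l < n)
    {α β : ℝ} (hc : Cover j i α β) :
    StrictCover j l (-(n + 1) * α) (-(n + 1) * β + n * n + n - 1) := by
  have hn2' : (2 : ℝ) ≤ n := by exact_mod_cast h.two_le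
  have hin' : (i : ℝ) + 1 = n := by exact_mod_cast hin
  have hl' : (l : ℝ) + 1 ≤ n := by exact_mod_cast hl
  have hl0 : (0 : ℝ) ≤ l := l.cast_nonneg
  rcases hc with ⟨h1, h2⟩ | ⟨h1, h2⟩
  · right; constructor <;> nlinarith
  · left; constructor <;> nlinarith

theorem strictCover_last_neg (h : IsOddLapMap n p) {j i : ℕ} (hin : i + 1 = n)
    {α β : ℝ} (hc : Cover j i α β) :
    StrictCover j 0 ((n + 1) * α) ((n + 1) * β - n * n - n + 1) := by
  have hn2' : (2 : ℝ) ≤ n := by exact_mod_cast h.two_le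
  have hin' : (i : ℝ) + 1 = n := by exact_mod_cast hin
  rcases hc with ⟨h1, h2⟩ | ⟨h1, h2⟩
  · left; push_cast; constructor <;> nlinarith
  · right; unfold ReversedCover; push_cast; constructor <;> nlinarith

theorem encard_returnSet_zero_of_strictCover {j i : ℕ} (ε : ℤˣ) {α β : ℝ}
    (hc : StrictCover j i α β) :
    (returnSet p j 0 i ε α β).encard = (lapWalks n j 0 i ε : ℕ) := by
  have hj0 : (0 : ℝ) ≤ j := j.cast_nonneg
  have hi0 : (0 : ℝ) ≤ i := i.cast_nonneg
  simp only [lapWalks]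
  split_ifs with hij
  · obtain ⟨rfl, rfl⟩ := hij
    have hα : (1 - α) ≠ 0 := by
      intro h0
      have : α = 1 := by linarith
      subst this
      rcases hc with ⟨h1, h2⟩ | ⟨h1, h2⟩ <;> linarith
    rw [Nat.cast_one, Set.encard_eq_one]
    refine ⟨β / (1 - α), ?_⟩
    ext x
    simp only [returnSet, Set.mem_ofPred_eq, Set.mem_singleton_iff, Function.iterate_zero, id,
      Units.val_one, Int.cast_one, one_mul, eq_div_iff hα]
    constructor
    · rintro ⟨_, z, _, rfl, h2⟩
      linarith
    · intro hx
      have hx' : α * x + β = x := by linarith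
      have hmem : (i : ℝ) < x ∧ x ≤ i + 1 := by
        rcases hc with ⟨h1, h2⟩ | ⟨h1, h2⟩
        · have : 1 < α := by nlinarith
          constructor <;> nlinarith
        · have : α < 0 := by nlinarith
          constructor <;> nlinarith
      exact ⟨hmem, x, hmem, rfl, hx'⟩
  · rw [Nat.cast_zero, Set.encard_eq_zero, Set.eq_empty_iff_forall_notMem]
    rintro x ⟨hx, z, hz, hxz, -⟩
    rcases Int.units_eq_one_or ε with rfl | rfl
    · simp only [Function.iterate_zero, id, Units.val_one, Int.cast_one, one_mul] at hxz
      subst hxz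
      refine hij ⟨?_, rfl⟩
      have h1 : (i : ℝ) < j + 1 := by linarith
      have h2 : (j : ℝ) < i + 1 := by linarith
      norm_cast at h1 h2
      omega
    · simp only [Function.iterate_zero, id, Units.val_neg, Units.val_one, Int.cast_neg,
        Int.cast_one] at hxz
      linarith

theorem encard_returnSet_of_strictCover (h : IsOddLapMap n p) {j : ℕ} (k : ℕ) :
    ∀ (i : ℕ) (_ : i < n) (ε : ℤˣ) (α β : ℝ), StrictCover j i α β →
      (returnSet p j k i ε α β).encard = (lapWalks n j k i ε : ℕ) := by
  have hn2 := h.two_le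
  induction k with
  | zero => intro i _ ε α β hc; exact encard_returnSet_zero_of_strictCover ε hc
  | succ k ih =>
    intro i hi ε α β hc
    rcases Nat.eq_zero_or_pos i with rfl | h0
    · rw [h.encard_returnSet_succ_zero, lapWalks_succ_zero, Nat.cast_add,
        ih 0 (by omega), ih 1 (by omega)]
      all_goals
        unfold StrictCover ReversedCover at *
        push_cast at *
        rcases hc with ⟨h1, h2⟩ | ⟨h1, h2⟩
      · left; constructor <;> linarith
      · right; constructor <;> linarith
      · left; constructor <;> linarith
      · right; constructor <;> linarith
    · rcases (show i + 1 ≤ n from hi).lt_or_eq with hin | hin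
      · rw [h.encard_returnSet_succ_mid h0.ne' hin, lapWalks_succ_mid _ h0.ne' hin,
          ih _ hin]
        unfold StrictCover ReversedCover at *
        push_cast
        rcases hc with ⟨h1, h2⟩ | ⟨h1, h2⟩
        · left; constructor <;> linarith
        · right; constructor <;> linarith
      · rw [h.encard_returnSet_succ_last hin _ _ _ hc.cover, lapWalks_succ_last _ h0.ne' hin,
          Nat.cast_add, Nat.cast_sum, ih 0 (by omega) _ _ _ (h.strictCover_last_neg hin hc.cover)]
        congr 1
        exact Finset.sum_congr rfl fun l hl =>
          ih l (Finset.mem_range.1 hl) _ _ _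
            (h.strictCover_last hin (Finset.mem_range.1 hl) hc.cover)

theorem encard_returnSet_translate (h : IsOddLapMap n p) {j : ℕ} (k : ℕ) :
    ∀ (i : ℕ) (_ : i < n) (_ : 0 < i) (_ : j ≤ i) (_ : j < i ∨ 0 < k) (ε : ℤˣ),
      (returnSet p j k i ε 1 (i - j)).encard = (lapWalks n j k i ε : ℕ) := by
  have hn2 := h.two_le
  induction k with
  | zero =>
    intro i _ _ _ hji ε
    have hji : j < i := by omega
    have hji' : (j : ℝ) + 1 ≤ i := by exact_mod_cast hji
    simp only [lapWalks, show i ≠ j by omega, false_and, if_false, Nat.cast_zero]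
    rw [Set.encard_eq_zero, Set.eq_empty_iff_forall_notMem]
    rintro x ⟨hx, z, hz, hxz, -⟩
    have hj0 : (0 : ℝ) ≤ j := j.cast_nonneg
    rcases Int.units_eq_one_or ε with rfl | rfl <;> simp at hxz <;> linarith
  | succ k ih =>
    intro i hi h0 hji _ ε
    have hc : Cover j i 1 (i - j) := Or.inl ⟨by linarith, by linarith⟩
    rcases (show i + 1 ≤ n from hi).lt_or_eq with hin | hin
    · rw [h.encard_returnSet_succ_mid h0.ne' hin, lapWalks_succ_mid _ h0.ne' hin,
        ← ih _ hin (by omega) (by omega) (by omega)]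
      congr 2; push_cast; ring
    · rw [h.encard_returnSet_succ_last hin _ _ _ hc, lapWalks_succ_last _ h0.ne' hin,
        Nat.cast_add, Nat.cast_sum,
        h.encard_returnSet_of_strictCover k 0 (by omega) _ _ _ (h.strictCover_last_neg hin hc)]
      congr 1
      exact Finset.sum_congr rfl fun l hl =>
        h.encard_returnSet_of_strictCover k l (Finset.mem_range.1 hl) _ _ _
          (h.strictCover_last hin (Finset.mem_range.1 hl) hc)

theorem encard_returnSet_zero_lap (h : IsOddLapMap n p) (k : ℕ) :
    ∀ α : ℝ, 1 ≤ α → (1 < α ∨ 0 < k) →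
      (returnSet p 0 k 0 1 α 0).encard + 1 = (lapWalks n 0 k 0 1 : ℕ) := by
  have hn2 := h.two_le
  induction k with
  | zero =>
    intro α _ hα
    have hα : 1 < α := by simpa using hα
    have : returnSet p 0 0 0 1 α 0 = ∅ := by
      rw [Set.eq_empty_iff_forall_notMem]
      rintro x ⟨hx, z, hz, hxz, hL⟩
      simp at hx hz hxz hL
      subst hxz
      nlinarith
    rw [this]; simp [lapWalks]
  | succ k ih =>
    intro α hα _
    have := ih (2 * α) (by linarith) (Or.inl (by linarith))
    rw [h.encard_returnSet_succ_zero, lapWalks_succ_zero, Nat.cast_add, ← this, mul_zero,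
      h.encard_returnSet_of_strictCover k 1 (by omega)]
    · rw [add_right_comm]
    · left; push_cast; constructor <;> linarith

theorem encard_pos_fixedPoints (h : IsOddLapMap n p) {k : ℕ} (hk : 0 < k) :
    {x : ℝ | (0 < x ∧ x ≤ n) ∧ p^[k] x = x}.encard + 1 = (closedLapWalks n k 1 : ℕ) := by
  have e1 := encard_setOf_lt_le_eq_sum {x : ℝ | p^[k] x = x} id n
  have e2 : ∀ l : ℕ, {x ∈ {x : ℝ | p^[k] x = x} | (l : ℝ) < id x ∧ id x ≤ l + 1} =
      returnSet p l k l 1 1 0 := by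
    intro l
    ext x
    simp only [returnSet, Set.mem_ofPred_eq, id, Units.val_one, Int.cast_one, one_mul, add_zero]
    constructor
    · rintro ⟨h1, h2⟩; exact ⟨h2, x, h2, h1, rfl⟩
    · rintro ⟨h1, z, _, h2, rfl⟩; exact ⟨h2, h1⟩
  have e3 : {x ∈ {x : ℝ | p^[k] x = x} | 0 < id x ∧ id x ≤ n} =
      {x : ℝ | (0 < x ∧ x ≤ n) ∧ p^[k] x = x} := by
    ext x; simp [and_comm]
  obtain ⟨m, rfl⟩ : ∃ m, n = m + 1 := ⟨n - 1, by have := h.two_le; omega⟩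
  rw [← e3, e1, closedLapWalks, Finset.sum_range_succ', Finset.sum_range_succ', add_assoc, e2 0,
    h.encard_returnSet_zero_lap k 1 le_rfl (Or.inr hk), Nat.cast_add, Nat.cast_sum]
  congr 1
  refine Finset.sum_congr rfl fun l hl => ?_
  rw [Finset.mem_range] at hl
  rw [e2, ← h.encard_returnSet_translate k (l + 1) (by omega) (by omega) le_rfl (Or.inr hk),
    sub_self]

theorem finite_and_ncard_fixedPoints (h : IsOddLapMap n p) {k : ℕ} (hk : 0 < k) :
    {x ∈ Set.Icc (-(n : ℝ)) (n : ℝ) | p^[k] x = x}.Finite ∧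
      ({x ∈ Set.Icc (-(n : ℝ)) (n : ℝ) | p^[k] x = x}.ncard : ℤ) =
        2 * closedLapWalks n k 1 - 1 := by
  have hn : (2 : ℝ) ≤ n := by exact_mod_cast h.two_le
  set P : Set ℝ := {x : ℝ | (0 < x ∧ x ≤ n) ∧ p^[k] x = x} with hP
  have hcard := h.encard_pos_fixedPoints hk
  have hfin : P.Finite := by
    rw [← Set.encard_lt_top_iff]
    refine lt_of_le_of_lt le_self_add (hcard.trans_lt ?_)
    exact ENat.natCast_lt_top _
  rw [← hP, ← hfin.cast_ncard_eq] at hcard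
  have hcard' : P.ncard + 1 = closedLapWalks n k 1 := by exact_mod_cast hcard
  have hsplit : {x ∈ Set.Icc (-(n : ℝ)) (n : ℝ) | p^[k] x = x} =
      insert 0 (P ∪ (fun x => -x) '' P) := by
    ext x
    simp only [hP, Set.mem_ofPred_eq, Set.mem_insert_iff, Set.mem_union, Set.mem_image, Set.mem_Icc]
    constructor
    · rintro ⟨⟨h1, h2⟩, h3⟩
      rcases lt_trichotomy x 0 with h0 | h0 | h0
      · refine Or.inr (Or.inr ⟨-x, ⟨⟨by linarith, by linarith⟩, ?_⟩, neg_neg x⟩)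
        rw [h.iterate_neg k x ⟨h1, h2⟩, h3]
      · exact Or.inl h0
      · exact Or.inr (Or.inl ⟨⟨h0, h2⟩, h3⟩)
    · rintro (rfl | ⟨⟨h1, h2⟩, h3⟩ | ⟨y, ⟨⟨h1, h2⟩, h3⟩, rfl⟩)
      · exact ⟨⟨by linarith, by linarith⟩, h.iterate_zero k⟩
      · exact ⟨⟨by linarith, h2⟩, h3⟩
      · refine ⟨⟨by linarith, by linarith⟩, ?_⟩
        rw [h.iterate_neg k y ⟨by linarith, h2⟩, h3]
  have hfin' : (P ∪ (fun x => -x) '' P).Finite := hfin.union (hfin.image _)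
  have h0 : (0 : ℝ) ∉ P ∪ (fun x => -x) '' P := by
    rintro (⟨⟨h1, _⟩, _⟩ | ⟨y, ⟨⟨h1, _⟩, _⟩, h2⟩)
    · exact lt_irrefl _ h1
    · have : -y = 0 := h2
      linarith
  have hdisj : Disjoint P ((fun x => -x) '' P) := by
    rw [Set.disjoint_left]
    rintro _ ⟨⟨h1, _⟩, _⟩ ⟨y, ⟨⟨h2, _⟩, _⟩, rfl⟩
    have : 0 < -y := h1
    linarith
  rw [hsplit]
  refine ⟨hfin'.insert 0, ?_⟩
  rw [Set.ncard_insert_of_notMem h0 hfin', Set.ncard_union_eq hdisj hfin (hfin.image _),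
    Set.ncard_image_of_injective _ neg_injective, ← hcard']
  push_cast
  ring

theorem of_affOn (hn : 2 ≤ n)
    (hmaps : Set.MapsTo p (Set.Icc (-(n : ℝ)) (n : ℝ)) (Set.Icc (-(n : ℝ)) (n : ℝ)))
    (hodd : ∀ x ∈ Set.Icc (-(n : ℝ)) (n : ℝ), p (-x) = - p x)
    (hp0 : p 0 = 0)
    (hpi : ∀ i : ℕ, 1 ≤ i → i ≤ n - 1 → p (i : ℝ) = (i : ℝ) + 1)
    (hpn : p (n : ℝ) = -1)
    (haff : ∀ j : ℤ, -(n : ℤ) ≤ j → j ≤ (n : ℤ) - 1 → AffOn p (j : ℝ) ((j : ℝ) + 1)) :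
    IsOddLapMap n p where
  two_le := hn
  mapsTo := hmaps
  odd := hodd
  zero := hp0
  first := by
    intro x h0 h1
    have h2 := haff 0 (by omega) (by omega) x ⟨by simpa using h0, by simpa using h1⟩
    have h3 := hpi 1 le_rfl (by omega)
    rw [Nat.cast_one] at h3
    simp only [Int.cast_zero, zero_add, hp0, h3] at h2
    rw [h2]; ring
  mid := by
    intro x h1 hx
    have hx0 : 0 ≤ x := by linarith
    have hm1 : 1 ≤ ⌊x⌋₊ := Nat.le_floor (by simpa using h1)
    have hm2 := Nat.floor_le hx0
    have hm3 := Nat.lt_floor_add_one x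
    set m := ⌊x⌋₊
    have hmn : m + 1 ≤ n := by
      have : (m : ℝ) + 1 ≤ n := by linarith
      exact_mod_cast this
    have hpm := hpi m hm1 (by omega)
    rcases hm2.eq_or_lt with hmx | hmx
    · rw [← hmx, hpm]
    have hmn' : m + 1 < n := by
      have : (m : ℝ) + 1 < n := by linarith
      exact_mod_cast this
    have h2 := haff m (by omega) (by omega) x ⟨by simpa using hm2, by simpa using hm3.le⟩
    have h3 := hpi (m + 1) (by omega) (by omega)
    push_cast at h2 h3
    rw [hpm, h3] at h2
    rw [h2]
    field_simp
    ring
  last := by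
    intro x h1 h2
    have h3 := hpi (n - 1) (by omega) le_rfl
    have h4 := haff ((n : ℤ) - 1) (by omega) le_rfl x
      ⟨by push_cast; linarith, by push_cast; linarith⟩
    push_cast [show 1 ≤ n by omega] at h3 h4
    rw [sub_add_cancel] at h3 h4
    rw [h3, hpn, sub_sub_cancel] at h4
    rw [h4]
    ring

end IsOddLapMap

/-- For `n ≥ 2`, the continuous odd map `p_n : [-n, n] → [-n, n]` has exactly `a_{2n,k}`
fixed points of its `k`-th iterate. -/
theorem statement17 (n : ℕ) (hn : 2 ≤ n) (p : ℝ → ℝ)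
    (hmaps : Set.MapsTo p (Set.Icc (-(n : ℝ)) (n : ℝ)) (Set.Icc (-(n : ℝ)) (n : ℝ)))
    (hcont : ContinuousOn p (Set.Icc (-(n : ℝ)) (n : ℝ)))
    (hodd : ∀ x ∈ Set.Icc (-(n : ℝ)) (n : ℝ), p (-x) = - p x)
    (hp0 : p 0 = 0)
    (hpi : ∀ i : ℕ, 1 ≤ i → i ≤ n - 1 → p (i : ℝ) = (i : ℝ) + 1)
    (hpn : p (n : ℝ) = -1)
    (haff : ∀ j : ℤ, -(n : ℤ) ≤ j → j ≤ (n : ℤ) - 1 → AffOn p (j : ℝ) ((j : ℝ) + 1))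
    (a : ℕ → ℤ)
    (haLow : ∀ k : ℕ, 1 ≤ k → k ≤ 2 * n - 1 → a k = 2 ^ (k + 1) - 1)
    (haRec : ∀ k : ℕ, 2 * n ≤ k →
      a k = 3 * a (k - 1) - ∑ i ∈ Finset.Icc 2 (2 * n - 1), a (k - i))
    (k : ℕ) (hk : 0 < k) :
    {x ∈ Set.Icc (-(n : ℝ)) (n : ℝ) | p^[k] x = x}.Finite ∧
      ({x ∈ Set.Icc (-(n : ℝ)) (n : ℝ) | p^[k] x = x}.ncard : ℤ) = a k := by
  have h := IsOddLapMap.of_affOn hn hmaps hodd hp0 hpi hpn haff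
  obtain ⟨hfin, hcard⟩ := h.finite_and_ncard_fixedPoints hk
  exact ⟨hfin, hcard.trans (eq_closedLapWalks hn a haLow haRec k hk).symm⟩
end

section
/- For every integer n ≥ 2, let p_n : [−n,n] → [−n,n] be the continuous odd map (p_n(−x) = −p_n(x)) with p_n(0) = 0, p_n(i) = i+1 for every integer 1 ≤ i ≤ n−1, p_n(n) = −1, and p_n affine on each interval [j,j+1] for integers −n ≤ j ≤ n−1. Then for every positive integer k, the set {x ∈ [−n,n] : p_n^k(x) = −x} is finite and has exactly s_{n,k} elements. -/
/-- The number of itineraries of length `k` from the cell `c` to the cell `b` (cell `i` being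
`(i, i + 1]`), up to the overall sign `s`. -/
def branchCount (n b : ℕ) : ℕ → Bool → ℕ → ℕ
  | 0, s, c => if s = true ∧ c = b then 1 else 0
  | k + 1, s, c =>
    if c = 0 then branchCount n b k s 0 + branchCount n b k s 1
    else if c + 1 < n then branchCount n b k s (c + 1)
    else ∑ j ∈ Finset.range n, branchCount n b k s j + branchCount n b k (!s) 0

theorem sum_branchCount_succ {n : ℕ} (b k : ℕ) (s : Bool) {i : ℕ} (hi : i + 1 < n) :
    ∑ j ∈ Finset.range (i + 1), branchCount n b (k + 1) s j =
      ∑ j ∈ Finset.range (i + 2), branchCount n b k s j := by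
  induction i with
  | zero => simp [branchCount, Finset.sum_range_succ]
  | succ i ih =>
    rw [Finset.sum_range_succ, ih (by omega), Finset.sum_range_succ _ (i + 2)]
    congr 1
    simp only [branchCount]
    rw [if_neg (by omega), if_pos hi]

theorem sum_branchCount {n : ℕ} (b : ℕ) (s : Bool) {i : ℕ} (hi : i < n) (k : ℕ) :
    ∑ j ∈ Finset.range (i + 1), branchCount n b k s j = branchCount n b (k + i) s 0 := by
  induction i generalizing k with
  | zero => simp
  | succ i ih =>
    rw [← sum_branchCount_succ b k s hi, ih (by omega), Nat.add_right_comm, Nat.add_assoc]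

theorem branchCount_zero_rec {n : ℕ} (hn : 2 ≤ n) (b k : ℕ) (s : Bool) :
    branchCount n b (k + n) s 0 =
      2 * branchCount n b (k + n - 1) s 0 + branchCount n b k (!s) 0 := by
  obtain ⟨m, rfl⟩ : ∃ m, n = m + 2 := ⟨n - 2, by omega⟩
  have h1 := sum_branchCount b s (show m + 1 < m + 2 by omega) (k + 1)
  have h2 := sum_branchCount b s (show m + 1 < m + 2 by omega) k
  have h3 := sum_branchCount_succ b k s (show m + 1 < m + 2 by omega)
  rw [Finset.sum_range_succ, h3] at h1
  have h4 : branchCount (m + 2) b (k + 1) s (m + 1) =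
      ∑ j ∈ Finset.range (m + 2), branchCount (m + 2) b k s j
        + branchCount (m + 2) b k (!s) 0 := by
    simp [branchCount]
  rw [h4, h2] at h1
  rw [show k + (m + 2) = k + 1 + (m + 1) by ring, ← h1,
    show k + 1 + (m + 1) - 1 = k + (m + 1) by omega]
  ring

theorem branchCount_zero_of_lt {n : ℕ} (b : ℕ) (s : Bool) {j : ℕ} (hj : j < n) :
    branchCount n b j s 0 = if s = true ∧ b ≤ j then 1 else 0 := by
  have h := sum_branchCount b s hj 0
  rw [Nat.zero_add] at h
  rw [← h]
  cases s <;> simp [branchCount]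

theorem branchCount_succ_cell {n : ℕ} (b k : ℕ) (s : Bool) {c : ℕ} (hc : c + 1 < n) :
    (branchCount n b k s (c + 1) : ℤ) =
      branchCount n b (k + c + 1) s 0 - branchCount n b (k + c) s 0 := by
  have h1 := sum_branchCount b s hc k
  have h2 := sum_branchCount b s (show c < n by omega) k
  rw [Finset.sum_range_succ, h2] at h1
  rw [Nat.add_assoc, ← h1]
  push_cast
  ring

theorem branchCount_rec {n : ℕ} (hn : 2 ≤ n) (b k : ℕ) (s : Bool) {c : ℕ} (hc : c < n) :
    (branchCount n b (k + n) s c : ℤ) =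
      2 * branchCount n b (k + n - 1) s c + branchCount n b k (!s) c := by
  cases c with
  | zero => exact_mod_cast branchCount_zero_rec hn b k s
  | succ c =>
    have h1 := branchCount_zero_rec hn b (k + c) s
    have h2 := branchCount_zero_rec hn b (k + c + 1) s
    rw [branchCount_succ_cell b _ s hc, branchCount_succ_cell b _ s hc,
      branchCount_succ_cell b _ _ hc]
    rw [show k + n + c + 1 = k + c + 1 + n by ring, show k + n + c = k + c + n by ring,
      show k + n - 1 + c + 1 = k + c + 1 + n - 1 by omega,
      show k + n - 1 + c = k + c + n - 1 by omega, h1, h2]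
    push_cast
    ring

theorem branchCount_zero_true {n : ℕ} (hn : 2 ≤ n) {b : ℕ} (hb : b < n) {j : ℕ} (hj : j < n) :
    branchCount n b (n + j) true 0 = 2 ^ (j + 1) := by
  induction j with
  | zero =>
    have h := branchCount_zero_rec hn b 0 true
    rw [Nat.zero_add] at h
    rw [Nat.add_zero, h, branchCount_zero_of_lt b _ (by omega), branchCount_zero_of_lt b _ (by omega)]
    simp
    omega
  | succ j ih =>
    have h := branchCount_zero_rec hn b (j + 1) true
    rw [show j + 1 + n = n + (j + 1) by ring, show n + (j + 1) - 1 = n + j by omega,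
      ih (by omega), branchCount_zero_of_lt b (!true) hj] at h
    rw [h]
    simp
    ring

theorem branchCount_zero_false {n : ℕ} (hn : 2 ≤ n) {b : ℕ} (hb : b < n) {j : ℕ}
    (hj : j < n + b) : branchCount n b j false 0 = 0 := by
  induction j using Nat.strong_induction_on with
  | _ j ih =>
    by_cases h : j < n
    · rw [branchCount_zero_of_lt b _ h]; simp
    · obtain ⟨i, rfl⟩ : ∃ i, j = i + n := ⟨j - n, by omega⟩
      rw [branchCount_zero_rec hn, ih _ (by omega) (by omega),
        branchCount_zero_of_lt b _ (by omega)]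
      simp
      omega

/-- The number of closed itineraries of length `k`, up to the overall sign `s`. -/
def diagCount (n k : ℕ) (s : Bool) : ℤ := ∑ b ∈ Finset.range n, (branchCount n b k s b : ℤ)

theorem diagCount_rec {n : ℕ} (hn : 2 ≤ n) (k : ℕ) (s : Bool) :
    diagCount n (k + n) s = 2 * diagCount n (k + n - 1) s + diagCount n k (!s) := by
  unfold diagCount
  rw [Finset.mul_sum, ← Finset.sum_add_distrib]
  exact Finset.sum_congr rfl fun b hb => branchCount_rec hn b k s (Finset.mem_range.1 hb)

theorem diagCount_zero_true (n : ℕ) : diagCount n 0 true = n := by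
  simp [diagCount, branchCount]

theorem diagCount_false {n : ℕ} (hn : 2 ≤ n) {k : ℕ} (hk : k < n) :
    diagCount n k false = 0 := by
  refine Finset.sum_eq_zero fun b hb => ?_
  have hb := Finset.mem_range.1 hb
  cases b with
  | zero => rw [branchCount_zero_false hn hb (by omega)]; rfl
  | succ b =>
    rw [branchCount_succ_cell _ _ _ hb, branchCount_zero_false hn hb (by omega),
      branchCount_zero_false hn hb (by omega)]
    rfl

theorem diagCount_true {n : ℕ} (hn : 2 ≤ n) {k : ℕ} (hk : 0 < k) (hkn : k < n) :
    diagCount n k true = 2 ^ k := by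
  obtain ⟨m, rfl⟩ : ∃ m, n = (m + 1) + k := ⟨n - k - 1, by omega⟩
  unfold diagCount
  rw [Finset.sum_range_add, Finset.sum_range_succ']
  have h1 : ∀ b ∈ Finset.range m,
      (branchCount (m + 1 + k) (b + 1) k true (b + 1) : ℤ) = 0 := by
    intro b hb
    have hb := Finset.mem_range.1 hb
    rw [branchCount_succ_cell _ _ _ (by omega), branchCount_zero_of_lt _ _ (by omega),
      branchCount_zero_of_lt _ _ (by omega), if_pos ⟨rfl, by omega⟩, if_pos ⟨rfl, by omega⟩]
    simp
  have h2 : ∀ i ∈ Finset.range k,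
      (branchCount (m + 1 + k) (m + 1 + i) k true (m + 1 + i) : ℤ) = 2 ^ i := by
    intro i hi
    have hi := Finset.mem_range.1 hi
    rw [show m + 1 + i = m + i + 1 by ring, branchCount_succ_cell _ _ _ (by omega),
      show k + (m + i) + 1 = m + 1 + k + i by ring, branchCount_zero_true hn (by omega) (by omega)]
    cases i with
    | zero =>
      rw [branchCount_zero_of_lt _ _ (by omega), if_pos ⟨rfl, by omega⟩]
      norm_num
    | succ i =>
      rw [show k + (m + (i + 1)) = m + 1 + k + i by ring,
        branchCount_zero_true hn (by omega) (by omega)]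
      push_cast
      ring
  rw [Finset.sum_eq_zero h1, Finset.sum_congr rfl h2, branchCount_zero_of_lt _ _ (by omega)]
  have h3 := geom_sum_mul (2 : ℤ) k
  rw [if_pos ⟨rfl, by omega⟩]
  push_cast
  linarith

theorem diagCount_false_mid {n : ℕ} (hn : 2 ≤ n) {j : ℕ} (hj : j < n) :
    diagCount n (j + n) false = 2 ^ j * ((j : ℤ) + n) := by
  induction j with
  | zero =>
    rw [diagCount_rec hn, diagCount_false hn (by omega)]
    simp [diagCount_zero_true]
  | succ j ih =>
    rw [diagCount_rec hn, show j + 1 + n - 1 = j + n by omega, ih (by omega), Bool.not_false,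
      diagCount_true hn (by omega) hj]
    push_cast
    ring

theorem diagCount_false_rec {n : ℕ} (hn : 2 ≤ n) (k : ℕ) :
    diagCount n (k + 2 * n) false = 4 * diagCount n (k + 2 * n - 1) false
      - 4 * diagCount n (k + 2 * n - 2) false + diagCount n k false := by
  have h1 := diagCount_rec hn (k + n) false
  have h2 := diagCount_rec hn (k + n - 1) false
  have h3 := diagCount_rec hn k true
  rw [show k + n - 1 + n = k + n + n - 1 by omega] at h2
  rw [show k + 2 * n = k + n + n by ring]
  rw [show k + n + n - 1 - 1 = k + n + n - 2 by omega] at h2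
  simp only [Bool.not_true, Bool.not_false] at h1 h2 h3
  linarith

theorem sum_two_pow_mul_add (m n : ℕ) :
    ∑ j ∈ Finset.range m, (2 : ℤ) ^ j * ((j : ℤ) + n) = 2 ^ m * ((m : ℤ) + n - 2) - n + 2 := by
  induction m with
  | zero => simp
  | succ m ih => rw [Finset.sum_range_succ, ih]; push_cast; ring

theorem diagCount_sum_rec {n : ℕ} (hn : 2 ≤ n) (k : ℕ) :
    (1 + 2 * diagCount n (k + 2 * n - 1) false) = 3 * (1 + 2 * diagCount n (k + 2 * n - 2) false)
      - ∑ j ∈ Finset.range (2 * n - 2), (1 + 2 * diagCount n (k + j) false) := by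
  obtain ⟨m, rfl⟩ : ∃ m, n = m + 2 := ⟨n - 2, by omega⟩
  induction k with
  | zero =>
    have e1 := diagCount_false_mid hn (show m + 1 < m + 2 by omega)
    have e2 := diagCount_false_mid hn (show m < m + 2 by omega)
    rw [show 0 + 2 * (m + 2) - 1 = m + 1 + (m + 2) by omega,
      show 0 + 2 * (m + 2) - 2 = m + (m + 2) by omega,
      show 2 * (m + 2) - 2 = (m + 2) + m by omega, e1, e2, Finset.sum_range_add]
    have h1 : ∀ j ∈ Finset.range (m + 2), 1 + 2 * diagCount (m + 2) (0 + j) false = 1 := by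
      intro j hj
      rw [Nat.zero_add, diagCount_false hn (Finset.mem_range.1 hj)]
      rfl
    have h2 : ∀ j ∈ Finset.range m, 1 + 2 * diagCount (m + 2) (0 + (m + 2 + j)) false =
        1 + 2 * (2 ^ j * ((j : ℤ) + (m + 2 : ℕ))) := by
      intro j hj
      rw [← diagCount_false_mid hn (by have := Finset.mem_range.1 hj; omega)]
      congr 3
      omega
    rw [Finset.sum_congr rfl h1, Finset.sum_congr rfl h2, Finset.sum_add_distrib, ← Finset.mul_sum,
      sum_two_pow_mul_add]
    push_cast
    simp
    ring
  | succ k ih =>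
    have h := diagCount_false_rec hn k
    have e1 := Finset.sum_range_succ (fun j => 1 + 2 * diagCount (m + 2) (k + j) false)
      (2 * (m + 2) - 2)
    rw [Finset.sum_range_succ'] at e1
    have e2 : ∀ j, k + 1 + j = k + (j + 1) := fun j => by ring
    rw [show k + 1 + 2 * (m + 2) - 1 = k + 2 * (m + 2) by omega,
      show k + 1 + 2 * (m + 2) - 2 = k + 2 * (m + 2) - 1 by omega]
    simp only [e2]
    rw [show k + (2 * (m + 2) - 2) = k + 2 * (m + 2) - 2 by omega] at e1
    simp only [Nat.add_zero] at e1
    linarith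

theorem eq_one_add_two_mul_diagCount {n : ℕ} (hn : 2 ≤ n) (s : ℕ → ℤ)
    (hs1 : ∀ k : ℕ, 1 ≤ k → k ≤ n - 1 → s k = 1)
    (hs2 : ∀ k : ℕ, n ≤ k → k ≤ 2 * n - 1 → s k = 2 ^ (k - n) * (2 * (k : ℤ)) + 1)
    (hsRec : ∀ k : ℕ, 2 * n ≤ k →
      s k = 3 * s (k - 1) - ∑ i ∈ Finset.Icc 2 (2 * n - 1), s (k - i))
    {k : ℕ} (hk : 0 < k) : s k = 1 + 2 * diagCount n k false := by
  induction k using Nat.strong_induction_on with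
  | _ k ih =>
    rcases lt_or_ge k n with h1 | h1
    · rw [hs1 k hk (by omega), diagCount_false hn h1]; rfl
    rcases lt_or_ge k (2 * n) with h2 | h2
    · obtain ⟨j, rfl⟩ : ∃ j, k = j + n := ⟨k - n, by omega⟩
      rw [hs2 _ h1 (by omega), diagCount_false_mid hn (by omega), Nat.add_sub_cancel]
      push_cast
      ring
    · obtain ⟨i, rfl⟩ : ∃ i, k = i + 1 + 2 * n - 1 := ⟨k - 2 * n, by omega⟩
      rw [hsRec _ h2, diagCount_sum_rec hn (i + 1), ih _ (by omega) (by omega)]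
      rw [show i + 1 + 2 * n - 1 - 1 = i + 1 + 2 * n - 2 by omega]
      congr 1
      refine Finset.sum_bij' (fun j _ => 2 * n - 1 - j) (fun j _ => 2 * n - 1 - j) ?_ ?_ ?_ ?_ ?_
      · intro j hj; simp only [Finset.mem_Icc, Finset.mem_range] at *; omega
      · intro j hj; simp only [Finset.mem_Icc, Finset.mem_range] at *; omega
      · intro j hj; simp only [Finset.mem_Icc] at *; omega
      · intro j hj; simp only [Finset.mem_range] at *; omega
      · intro j hj
        simp only [Finset.mem_Icc] at hj
        rw [ih _ (by omega) (by omega)]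
        congr 3
        omega

/-- The sign `1` or `-1` encoded by a Boolean. -/
def boolSign (s : Bool) : ℝ := if s = true then 1 else -1

theorem boolSign_beq (s t : Bool) : boolSign (s == t) = boolSign t * boolSign s := by
  cases s <;> cases t <;> simp [boolSign]

theorem boolSign_mul_self (s : Bool) : boolSign s * boolSign s = 1 := by
  cases s <;> simp [boolSign]

/-- The explicit form of the map `p_n` on the unit cells of `[0, n]`, together with oddness. -/
structure IsCellMap (n : ℕ) (p : ℝ → ℝ) : Prop where
  mapsTo : Set.MapsTo p (Set.Icc (-(n : ℝ)) n) (Set.Icc (-(n : ℝ)) n)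
  odd : ∀ x ∈ Set.Icc (-(n : ℝ)) n, p (-x) = -p x
  first : ∀ x ∈ Set.Icc (0 : ℝ) 1, p x = 2 * x
  mid : ∀ c : ℕ, 1 ≤ c → c + 1 < n → ∀ x ∈ Set.Icc (c : ℝ) (c + 1), p x = x + 1
  last : ∀ x ∈ Set.Icc ((n : ℝ) - 1) n, p x = n - (n + 1) * (x - (n - 1))

namespace IsCellMap

variable {n : ℕ} {p : ℝ → ℝ}

theorem iterate_mem (hp : IsCellMap n p) (k : ℕ) {x : ℝ} (hx : x ∈ Set.Icc (-(n : ℝ)) n) :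
    p^[k] x ∈ Set.Icc (-(n : ℝ)) n :=
  hp.mapsTo.iterate k hx

theorem iterate_neg (hp : IsCellMap n p) (k : ℕ) {x : ℝ} (hx : x ∈ Set.Icc (-(n : ℝ)) n) :
    p^[k] (-x) = -p^[k] x := by
  induction k with
  | zero => rfl
  | succ k ih =>
    rw [Function.iterate_succ_apply', Function.iterate_succ_apply', ih,
      hp.odd _ (hp.iterate_mem k hx)]

theorem iterate_boolSign_mul (hp : IsCellMap n p) (k : ℕ) (t : Bool) {x : ℝ}
    (hx : x ∈ Set.Icc (-(n : ℝ)) n) : p^[k] (boolSign t * x) = boolSign t * p^[k] x := by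
  cases t
  · simpa [boolSign] using hp.iterate_neg k hx
  · simp [boolSign]

theorem iterate_zero (hp : IsCellMap n p) (k : ℕ) : p^[k] 0 = 0 :=
  Function.iterate_fixed (by simpa using hp.first 0 (by simp)) k

theorem exists_int_natCast (hp : IsCellMap n p) {c : ℕ} (hc : c ≤ n) :
    ∃ z : ℤ, p c = z := by
  rcases Nat.eq_zero_or_pos c with rfl | h0
  · exact ⟨0, by simpa using hp.iterate_zero 1⟩
  rcases lt_or_ge (c + 1) n with h1 | h1
  · exact ⟨c + 1, by rw [hp.mid c h0 h1 c (by simp)]; push_cast; rfl⟩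
  have h2 : (n : ℝ) - 1 ≤ c := by
    have : (n : ℝ) ≤ c + 1 := by exact_mod_cast h1
    linarith
  exact ⟨n - (n + 1) * (c - (n - 1)), by
    rw [hp.last c ⟨h2, by exact_mod_cast hc⟩]; push_cast; rfl⟩

theorem exists_int_intCast (hp : IsCellMap n p) {z : ℤ} (hz : (z : ℝ) ∈ Set.Icc (-(n : ℝ)) n) :
    ∃ w : ℤ, p z = w := by
  obtain ⟨c, rfl | rfl⟩ := z.eq_nat_or_neg
  · exact hp.exists_int_natCast (by exact_mod_cast hz.2)
  · have hc : c ≤ n := by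
      have := hz.1
      push_cast at this
      exact_mod_cast neg_le_neg_iff.1 this
    obtain ⟨w, hw⟩ := hp.exists_int_natCast hc
    refine ⟨-w, ?_⟩
    push_cast
    rw [hp.odd _ ⟨by linarith [Nat.cast_nonneg (α := ℝ) c, Nat.cast_nonneg (α := ℝ) n],
      by exact_mod_cast hc⟩, hw]

theorem exists_int_iterate (hp : IsCellMap n p) (k : ℕ) {z : ℤ}
    (hz : (z : ℝ) ∈ Set.Icc (-(n : ℝ)) n) : ∃ w : ℤ, p^[k] z = w := by
  induction k with
  | zero => exact ⟨z, rfl⟩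
  | succ k ih =>
    obtain ⟨w, hw⟩ := ih
    rw [Function.iterate_succ_apply', hw]
    exact hp.exists_int_intCast (hw ▸ hp.iterate_mem k hz)

end IsCellMap

/-- The points of the cell `(c, c + 1]` which the affine map `x ↦ m * x + d` sends into
`(b, b + 1]` and whose `k`-th iterate under `p` is the image under this map up to the sign `s`. -/
def branchSet (p : ℝ → ℝ) (b k : ℕ) (s : Bool) (c : ℕ) (m d : ℝ) : Set ℝ :=
  {x | x ∈ Set.Ioc (c : ℝ) (c + 1) ∧ m * x + d ∈ Set.Ioc (b : ℝ) (b + 1) ∧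
    p^[k] x = boolSign s * (m * x + d)}

/-- The affine maps from the cell `c` to the cell `b` that arise by composing inverse branches,
starting from the identity of the cell `b` with the sign `-1`. -/
structure IsInverseBranch (b c : ℕ) (s : Bool) (m d : ℝ) : Prop where
  ne_zero : m ≠ 0
  abs_le : |m| ≤ 1
  abs_lt : s = true → |m| < 1
  mapsTo : ∀ x ∈ Set.Icc (c : ℝ) (c + 1), m * x + d ∈ Set.Icc (b : ℝ) (b + 1)
  left_ne : m * c + d ≠ b + 1
  left_eq : m * c + d = b → b < c ∨ (b = c ∧ s = false)

theorem IsInverseBranch.mem_Ioo {b c : ℕ} {s : Bool} {m d : ℝ} (h : IsInverseBranch b c s m d)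
    {x : ℝ} (hx : x ∈ Set.Ioo (c : ℝ) (c + 1)) : m * x + d ∈ Set.Ioo (b : ℝ) (b + 1) := by
  have h1 := h.mapsTo c (by simp)
  have h2 := h.mapsTo (c + 1) (by simp)
  obtain ⟨hx1, hx2⟩ := hx
  rcases lt_or_gt_of_ne h.ne_zero with hm | hm
  · have := mul_lt_mul_of_neg_left hx1 hm
    have := mul_lt_mul_of_neg_left hx2 hm
    exact ⟨by linarith [h2.1], by linarith [h1.2]⟩
  · have := mul_lt_mul_of_pos_left hx1 hm
    have := mul_lt_mul_of_pos_left hx2 hm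
    exact ⟨by linarith [h1.1], by linarith [h2.2]⟩

/-- `y ↦ α * y + γ` is the inverse of the branch of `p` from the cell `c` onto the cell `c'`,
the latter taken with the sign `t`. -/
structure IsStep (p : ℝ → ℝ) (c c' : ℕ) (t : Bool) (α γ : ℝ) : Prop where
  ne_zero : α ≠ 0
  abs_le : |α| ≤ 1
  abs_lt : t = false → |α| < 1
  mapsTo : ∀ y ∈ Set.Icc (c' : ℝ) (c' + 1), α * y + γ ∈ Set.Icc (c : ℝ) (c + 1)
  apply_eq : ∀ y ∈ Set.Icc (c' : ℝ) (c' + 1), p (α * y + γ) = boolSign t * y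
  eq_of_apply_eq : ∀ x ∈ Set.Icc (c : ℝ) (c + 1), ∀ y, p x = boolSign t * y → x = α * y + γ
  left_ne : α * c' + γ ≠ c + 1
  left_eq : α * c' + γ = c → c < c' ∨ (c = c' ∧ t = true)

theorem IsInverseBranch.comp {p : ℝ → ℝ} {b c c' : ℕ} {s t : Bool} {m d α γ : ℝ}
    (h : IsInverseBranch b c s m d) (hs : IsStep p c c' t α γ) :
    IsInverseBranch b c' (s == t) (m * α) (m * γ + d) := by
  have key : ∀ y, m * α * y + (m * γ + d) = m * (α * y + γ) + d := fun y => by ring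
  have hmem := hs.mapsTo c' (by simp)
  have hcases : α * c' + γ = c ∨ m * (α * c' + γ) + d ∈ Set.Ioo (b : ℝ) (b + 1) := by
    rcases hmem.1.eq_or_lt with h1 | h1
    · exact Or.inl h1.symm
    · exact Or.inr (h.mem_Ioo ⟨h1, lt_of_le_of_ne hmem.2 hs.left_ne⟩)
  refine ⟨mul_ne_zero h.ne_zero hs.ne_zero, ?_, ?_, ?_, ?_, ?_⟩
  · rw [abs_mul]
    exact mul_le_one₀ h.abs_le (abs_nonneg _) hs.abs_le
  · intro hst
    rw [abs_mul]
    cases t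
    · exact mul_lt_one_of_nonneg_of_lt_one_right h.abs_le (abs_nonneg _) (hs.abs_lt rfl)
    · exact mul_lt_one_of_nonneg_of_lt_one_left (abs_nonneg _) (h.abs_lt (by simpa using hst))
        hs.abs_le
  · intro y hy
    rw [key]
    exact h.mapsTo _ (hs.mapsTo y hy)
  · rw [key]
    rcases hcases with h1 | h1
    · rw [h1]; exact h.left_ne
    · exact h1.2.ne
  · rw [key]
    intro heq
    rcases hcases with h1 | h1
    · rw [h1] at heq
      rcases h.left_eq heq with h2 | ⟨h2, h3⟩ <;> rcases hs.left_eq h1 with h4 | ⟨h4, h5⟩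
      · exact Or.inl (h2.trans h4)
      · exact Or.inl (h4 ▸ h2)
      · exact Or.inl (h2 ▸ h4)
      · exact Or.inr ⟨h2.trans h4, by rw [h3, h5]; rfl⟩
    · exact absurd heq h1.1.ne'

theorem branchSet_slice {n : ℕ} {p : ℝ → ℝ} (hp : IsCellMap n p) {b c c' : ℕ} {s t : Bool}
    {m d α γ : ℝ} (k : ℕ) (hc : c < n) (hc' : c' < n) (h : IsInverseBranch b c s m d)
    (hs : IsStep p c c' t α γ) :
    {x ∈ branchSet p b (k + 1) s c m d | boolSign t * p x ∈ Set.Ioc (c' : ℝ) (c' + 1)} =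
      (fun y => α * y + γ) '' branchSet p b k (s == t) c' (m * α) (m * γ + d) := by
  have key : ∀ y, m * α * y + (m * γ + d) = m * (α * y + γ) + d := fun y => by ring
  have hdom : ∀ y ∈ Set.Ioc (c' : ℝ) (c' + 1), y ∈ Set.Icc (-(n : ℝ)) n := by
    intro y hy
    have h1 : (c' : ℝ) + 1 ≤ n := by exact_mod_cast hc'
    exact ⟨by linarith [hy.1, Nat.cast_nonneg (α := ℝ) c', Nat.cast_nonneg (α := ℝ) n],
      hy.2.trans h1⟩
  have hiter : ∀ y ∈ Set.Ioc (c' : ℝ) (c' + 1),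
      p^[k + 1] (α * y + γ) = boolSign t * p^[k] y := by
    intro y hy
    rw [Function.iterate_succ_apply, hs.apply_eq y ⟨hy.1.le, hy.2⟩,
      hp.iterate_boolSign_mul k t (hdom y hy)]
  ext x
  constructor
  · rintro ⟨⟨hx1, hx2, hx3⟩, hx4⟩
    have hx : x = α * (boolSign t * p x) + γ :=
      hs.eq_of_apply_eq x ⟨hx1.1.le, hx1.2⟩ _ (by rw [← mul_assoc, boolSign_mul_self, one_mul])
    refine ⟨boolSign t * p x, ⟨hx4, ?_, ?_⟩, hx.symm⟩
    · rw [key, ← hx]; exact hx2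
    · have h1 := hiter _ hx4
      rw [← hx, hx3] at h1
      rw [key, ← hx, boolSign_beq, mul_assoc, h1, ← mul_assoc, boolSign_mul_self, one_mul]
  · rintro ⟨y, ⟨hy1, hy2, hy3⟩, rfl⟩
    have hy : y ∈ Set.Icc (c' : ℝ) (c' + 1) := ⟨hy1.1.le, hy1.2⟩
    rw [key] at hy2 hy3
    have hval : p^[k + 1] (α * y + γ) = boolSign s * (m * (α * y + γ) + d) := by
      rw [hiter y hy1, hy3, boolSign_beq, ← mul_assoc, ← mul_assoc, boolSign_mul_self, one_mul]
    have hmem := hs.mapsTo y hy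
    have hne : α * y + γ ≠ c := by
      intro heq
      rw [heq] at hy2 hval
      have hcn : ((c : ℤ) : ℝ) ∈ Set.Icc (-(n : ℝ)) n := by
        have h1 : (c : ℝ) ≤ n := by exact_mod_cast hc.le
        push_cast
        exact ⟨by linarith [Nat.cast_nonneg (α := ℝ) c, Nat.cast_nonneg (α := ℝ) n], h1⟩
      obtain ⟨w, hw⟩ := hp.exists_int_iterate (k + 1) hcn
      rw [Int.cast_natCast, hval] at hw
      have hlt := lt_of_le_of_ne hy2.2 h.left_ne
      obtain ⟨v, hv⟩ : ∃ v : ℤ, m * c + d = v := by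
        cases s
        · refine ⟨-w, ?_⟩
          push_cast
          rw [← hw]
          simp [boolSign]
        · refine ⟨w, ?_⟩
          rw [← hw]
          simp [boolSign]
      rw [hv] at hlt hy2
      have h1 : (b : ℤ) < v := by exact_mod_cast hy2.1
      have h2 : v < (b : ℤ) + 1 := by exact_mod_cast hlt
      omega
    refine ⟨⟨⟨lt_of_le_of_ne hmem.1 hne.symm, hmem.2⟩, hy2, hval⟩, ?_⟩
    simp only
    rw [hs.apply_eq y hy, ← mul_assoc, boolSign_mul_self, one_mul]
    exact hy1

theorem encard_branchSet_zero {n b c : ℕ} {p : ℝ → ℝ} {s : Bool} {m d : ℝ}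
    (h : IsInverseBranch b c s m d) :
    (branchSet p b 0 s c m d).encard = (branchCount n b 0 s c : ℕ) := by
  by_cases hsc : s = true ∧ c = b
  · obtain ⟨rfl, rfl⟩ := hsc
    have hm : 0 < 1 - m := by linarith [le_abs_self m, h.abs_lt rfl]
    have h1 := (h.mapsTo c (by simp)).1
    have h2 := (h.mapsTo (c + 1) (by simp)).2
    have hfix : m * (d / (1 - m)) + d = d / (1 - m) := by field_simp; ring
    have hne : d / (1 - m) ≠ c := by
      intro heq
      rw [heq] at hfix
      have := h.left_eq hfix
      simp at this
    have hmem : d / (1 - m) ∈ Set.Ioc (c : ℝ) (c + 1) := by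
      refine ⟨lt_of_le_of_ne ?_ hne.symm, ?_⟩
      · rw [le_div_iff₀ hm]; linarith
      · rw [div_le_iff₀ hm]; linarith
    have : branchSet p c 0 true c m d = {d / (1 - m)} := by
      ext x
      simp only [branchSet, Set.mem_ofPred_eq, Set.mem_singleton_iff, Function.iterate_zero, id,
        boolSign, if_true, one_mul]
      constructor
      · rintro ⟨-, -, hx⟩
        rw [eq_div_iff hm.ne']
        linarith
      · rintro rfl
        rw [hfix]
        exact ⟨hmem, hmem, rfl⟩
    rw [this, Set.encard_singleton]
    simp [branchCount]
  · have : branchSet p b 0 s c m d = ∅ := by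
      refine Set.eq_empty_of_forall_notMem ?_
      rintro x ⟨hx1, hx2, hx3⟩
      rw [Function.iterate_zero, id] at hx3
      cases s
      · simp only [boolSign] at hx3
        norm_num at hx3
        linarith [hx1.1, hx2.1, Nat.cast_nonneg (α := ℝ) c, Nat.cast_nonneg (α := ℝ) b]
      · simp only [boolSign, if_true, one_mul] at hx3
        rw [← hx3] at hx2
        have h1 : (c : ℝ) < b + 1 := hx1.1.trans_le hx2.2
        have h2 : (b : ℝ) < c + 1 := hx2.1.trans_le hx1.2
        have h1 : c < b + 1 := by exact_mod_cast h1
        have h2 : b < c + 1 := by exact_mod_cast h2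
        exact hsc ⟨rfl, by omega⟩
    rw [this, Set.encard_empty]
    simp [branchCount, hsc]

theorem encard_slices (S : Set ℝ) (f : ℝ → ℝ) (a : ℕ → ℕ) (m : ℕ)
    (h : ∀ j < m, {x ∈ S | f x ∈ Set.Ioc (j : ℝ) (j + 1)}.encard = (a j : ℕ)) :
    {x ∈ S | f x ∈ Set.Ioc (0 : ℝ) m}.encard = (∑ j ∈ Finset.range m, a j : ℕ) := by
  induction m with
  | zero => simp
  | succ m ih =>
    rw [Finset.sum_range_succ, Nat.cast_add (R := ℕ∞), ← ih fun j hj => h j (by omega),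
      ← h m (by omega), ← Set.encard_union_eq]
    · congr 1
      ext x
      have hm := Nat.cast_nonneg (α := ℝ) m
      simp only [Set.mem_ofPred_eq, Set.mem_union, Set.mem_Ioc]
      push_cast
      constructor
      · rintro ⟨hx, h1, h2⟩
        rcases le_or_gt (f x) m with h3 | h3
        · exact Or.inl ⟨hx, h1, h3⟩
        · exact Or.inr ⟨hx, h3, h2⟩
      · rintro (⟨hx, h1, h2⟩ | ⟨hx, h1, h2⟩)
        · exact ⟨hx, h1, by linarith⟩
        · exact ⟨hx, by linarith, h2⟩
    · rw [Set.disjoint_left]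
      rintro x ⟨-, -, h1⟩ ⟨-, h2, -⟩
      exact absurd h1 (not_le.2 h2)

theorem isStep_first {n : ℕ} {p : ℝ → ℝ} (hp : IsCellMap n p) {j : ℕ} (hj : j < 2) :
    IsStep p 0 j true (1 / 2) 0 := by
  have hmem : ∀ y ∈ Set.Icc (j : ℝ) (j + 1), 1 / 2 * y + 0 ∈ Set.Icc (0 : ℝ) 1 := by
    have h1 : (j : ℝ) ≤ 1 := by exact_mod_cast Nat.lt_succ_iff.1 hj
    rintro y ⟨h2, h3⟩
    exact ⟨by linarith [Nat.cast_nonneg (α := ℝ) j], by linarith⟩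
  refine ⟨by norm_num, by norm_num [abs_le], by simp, by simpa using hmem, ?_, ?_, ?_, ?_⟩
  · intro y hy
    rw [hp.first _ (hmem y hy)]
    simp [boolSign]
  · intro x hx y hxy
    rw [hp.first x (by simpa using hx)] at hxy
    simp only [boolSign, if_true] at hxy
    linarith
  · interval_cases j <;> norm_num
  · interval_cases j <;> norm_num

theorem isStep_mid {n : ℕ} {p : ℝ → ℝ} (hp : IsCellMap n p) {c : ℕ} (hc : 1 ≤ c)
    (hcn : c + 1 < n) : IsStep p c (c + 1) true 1 (-1) := by
  have hmem : ∀ y ∈ Set.Icc ((c + 1 : ℕ) : ℝ) ((c + 1 : ℕ) + 1),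
      1 * y + -1 ∈ Set.Icc (c : ℝ) (c + 1) := by
    rintro y ⟨h2, h3⟩
    push_cast at h2 h3
    exact ⟨by linarith, by linarith⟩
  refine ⟨by norm_num, by norm_num, by simp, hmem, ?_, ?_, ?_, fun _ => Or.inl (by omega)⟩
  · intro y hy
    rw [hp.mid c hc hcn _ (hmem y hy)]
    simp [boolSign]
  · intro x hx y hxy
    rw [hp.mid c hc hcn x hx] at hxy
    simp only [boolSign, if_true] at hxy
    linarith
  · push_cast
    linarith

theorem isStep_last {n : ℕ} {p : ℝ → ℝ} (hp : IsCellMap n p) {c j : ℕ} {t : Bool} (hcn : c + 1 = n)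
    (hj : j < n) (ht : t = false → j = 0) :
    IsStep p c j t (-boolSign t / (n + 1)) (c + n / (n + 1)) := by
  have hn0 : (1 : ℝ) ≤ n := by exact_mod_cast (by omega : 1 ≤ n)
  have hn : (0 : ℝ) < n + 1 := by linarith
  have hc : (c : ℝ) = n - 1 := by rw [← hcn]; push_cast; ring
  have habs : |-boolSign t / ((n : ℝ) + 1)| < 1 := by
    rw [abs_div, abs_neg, abs_of_pos hn, div_lt_one hn]
    cases t <;> simp [boolSign] <;> linarith
  have key : ∀ y, -boolSign t / ((n : ℝ) + 1) * y + (c + n / (n + 1)) =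
      c + (n - boolSign t * y) / (n + 1) := fun y => by ring
  have hbd : ∀ y ∈ Set.Icc (j : ℝ) (j + 1), -1 ≤ boolSign t * y ∧ boolSign t * y ≤ n := by
    rintro y ⟨h1, h2⟩
    have h3 : (j : ℝ) + 1 ≤ n := by exact_mod_cast hj
    have h4 := Nat.cast_nonneg (α := ℝ) j
    cases t
    · rw [ht rfl] at h1 h2
      norm_num at h1 h2
      simp only [boolSign]
      norm_num
      exact ⟨by linarith, by linarith⟩
    · simp only [boolSign, if_true]
      exact ⟨by linarith, by linarith⟩
  have hmem : ∀ y ∈ Set.Icc (j : ℝ) (j + 1),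
      c + (n - boolSign t * y) / (n + 1) ∈ Set.Icc (c : ℝ) (c + 1) := by
    intro y hy
    obtain ⟨h1, h2⟩ := hbd y hy
    have h3 : 0 ≤ (n - boolSign t * y) / ((n : ℝ) + 1) := div_nonneg (by linarith) hn.le
    have h4 : (n - boolSign t * y) / ((n : ℝ) + 1) ≤ 1 := by rw [div_le_one hn]; linarith
    exact ⟨by linarith, by linarith⟩
  have hlt : boolSign t * j < n ∧ -1 < boolSign t * j := by
    have h3 : (j : ℝ) + 1 ≤ n := by exact_mod_cast hj
    have h4 := Nat.cast_nonneg (α := ℝ) j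
    cases t
    · rw [ht rfl]; norm_num; linarith
    · simp only [boolSign, if_true]
      exact ⟨by linarith, by linarith⟩
  refine ⟨?_, habs.le, fun _ => habs, ?_, ?_, ?_, ?_, ?_⟩
  · refine div_ne_zero ?_ hn.ne'
    cases t <;> norm_num [boolSign]
  · intro y hy
    rw [key]
    exact hmem y hy
  · intro y hy
    rw [key]
    have := hmem y hy
    rw [hc] at this ⊢
    rw [hp.last _ ⟨this.1, by linarith [this.2]⟩]
    field_simp
    ring
  · intro x hx y hxy
    rw [hp.last x ⟨by linarith [hx.1], by linarith [hx.2]⟩] at hxy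
    rw [key, ← hxy, hc]
    field_simp
    ring
  · rw [key]
    have : (n - boolSign t * j) / ((n : ℝ) + 1) < 1 := by rw [div_lt_one hn]; linarith
    linarith
  · rw [key]
    have : 0 < (n - boolSign t * j) / ((n : ℝ) + 1) := div_pos (by linarith) hn
    intro heq
    linarith

theorem encard_branchSet {n : ℕ} (hn : 2 ≤ n) {p : ℝ → ℝ} (hp : IsCellMap n p) {b : ℕ} (k : ℕ)
    {s : Bool} {c : ℕ} {m d : ℝ} (hc : c < n) (h : IsInverseBranch b c s m d) :
    (branchSet p b k s c m d).encard = (branchCount n b k s c : ℕ) := by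
  induction k generalizing s c m d with
  | zero => exact encard_branchSet_zero h
  | succ k ih =>
    have hslice : ∀ {c' : ℕ} {t : Bool} {α γ : ℝ}, c' < n → IsStep p c c' t α γ →
        {x ∈ branchSet p b (k + 1) s c m d |
          boolSign t * p x ∈ Set.Ioc (c' : ℝ) (c' + 1)}.encard =
          (branchCount n b k (s == t) c' : ℕ) := by
      intro c' t α γ hc' hs
      rw [branchSet_slice hp k hc hc' h hs, Function.Injective.encard_image,
        ih hc' (h.comp hs)]
      intro x y hxy
      simpa [hs.ne_zero] using hxy
    have hslice' : ∀ {c' : ℕ} {α γ : ℝ}, c' < n → IsStep p c c' true α γ →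
        {x ∈ branchSet p b (k + 1) s c m d | p x ∈ Set.Ioc (c' : ℝ) (c' + 1)}.encard =
          (branchCount n b k s c' : ℕ) := by
      intro c' α γ hc' hs
      simpa [boolSign] using hslice hc' hs
    rcases Nat.eq_zero_or_pos c with rfl | hc0
    · have h1 := encard_slices (branchSet p b (k + 1) s 0 m d) p (branchCount n b k s) 2
        fun j hj => hslice' (by omega) (isStep_first hp hj)
      have h2 : {x ∈ branchSet p b (k + 1) s 0 m d | p x ∈ Set.Ioc (0 : ℝ) (2 : ℕ)} =
          branchSet p b (k + 1) s 0 m d := by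
        refine Set.sep_eq_self_iff_mem_true.2 ?_
        rintro x ⟨hx, -, -⟩
        norm_num at hx
        rw [hp.first x ⟨hx.1.le, hx.2⟩]
        norm_num
        exact ⟨hx.1, by linarith [hx.2]⟩
      rw [h2] at h1
      rw [h1]
      simp [branchCount, Finset.sum_range_succ]
    rcases lt_or_ge (c + 1) n with hcn | hcn
    · have h1 := hslice' hcn (isStep_mid hp hc0 hcn)
      have h2 : {x ∈ branchSet p b (k + 1) s c m d |
          p x ∈ Set.Ioc ((c + 1 : ℕ) : ℝ) ((c + 1 : ℕ) + 1)} =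
          branchSet p b (k + 1) s c m d := by
        refine Set.sep_eq_self_iff_mem_true.2 ?_
        rintro x ⟨hx, -, -⟩
        rw [hp.mid c hc0 hcn x ⟨hx.1.le, hx.2⟩]
        push_cast
        exact ⟨by linarith [hx.1], by linarith [hx.2]⟩
      rw [h2] at h1
      rw [h1]
      simp [branchCount, hc0.ne', hcn]
    · have hcn' : c + 1 = n := by omega
      have h1 := encard_slices (branchSet p b (k + 1) s c m d) p (branchCount n b k s) n
        fun j hj => hslice' hj (isStep_last hp hcn' hj (by simp))
      have h2 := hslice (c' := 0) (t := false) (by omega)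
        (isStep_last hp hcn' (by omega) (fun _ => rfl))
      have h3 : branchSet p b (k + 1) s c m d =
          {x ∈ branchSet p b (k + 1) s c m d | p x ∈ Set.Ioc (0 : ℝ) n} ∪
          {x ∈ branchSet p b (k + 1) s c m d |
            boolSign false * p x ∈ Set.Ioc ((0 : ℕ) : ℝ) ((0 : ℕ) + 1)} := by
        rw [← Set.sep_or]
        refine (Set.sep_eq_self_iff_mem_true.2 ?_).symm
        rintro x ⟨hx1, hx2, hx3⟩
        have hcr : (c : ℝ) = n - 1 := by rw [← hcn']; push_cast; ring
        have hpx := hp.last x ⟨by linarith [hx1.1], by linarith [hx1.2]⟩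
        have hne : p x ≠ 0 := by
          intro h0
          rw [Function.iterate_succ_apply, h0, hp.iterate_zero] at hx3
          have : 0 < m * x + d := lt_of_le_of_lt (Nat.cast_nonneg b) hx2.1
          cases s <;> simp [boolSign] at hx3 <;> linarith
        have hn0 := Nat.cast_nonneg (α := ℝ) n
        have h4 : p x ≤ n := by nlinarith [hx1.1]
        have h5 : -1 ≤ p x := by nlinarith [hx1.2]
        rcases lt_or_gt_of_ne hne with h6 | h6
        · right
          simp only [boolSign]
          norm_num
          exact ⟨h6, by linarith⟩
        · exact Or.inl ⟨h6, h4⟩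
      rw [h3, Set.encard_union_eq, h1, h2]
      · simp [branchCount, hc0.ne', hcn]
      · rw [Set.disjoint_left]
        rintro x ⟨-, h4, -⟩ ⟨-, h5, -⟩
        simp [boolSign] at h5
        linarith

theorem isInverseBranch_id (c : ℕ) : IsInverseBranch c c false 1 0 :=
  ⟨one_ne_zero, by simp, by simp, by simp, by simp, by simp⟩

theorem encard_eq_neg {n : ℕ} (hn : 2 ≤ n) {p : ℝ → ℝ} (hp : IsCellMap n p) (k : ℕ) :
    {x ∈ Set.Icc (-(n : ℝ)) n | p^[k] x = -x}.encard =
      (1 + 2 * ∑ b ∈ Finset.range n, branchCount n b k false b : ℕ) := by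
  set S := {x ∈ Set.Icc (-(n : ℝ)) n | p^[k] x = -x} with hS
  have hpos := encard_slices S id (fun b => branchCount n b k false b) n (by
    intro j hj
    rw [← encard_branchSet hn hp k hj (isInverseBranch_id j)]
    congr 1
    ext x
    have h1 : (j : ℝ) + 1 ≤ n := by exact_mod_cast hj
    have h2 := Nat.cast_nonneg (α := ℝ) j
    simp only [hS, branchSet, boolSign, id, Set.mem_ofPred_eq, Set.mem_Icc, Set.mem_Ioc]
    norm_num
    constructor
    · rintro ⟨⟨-, h3⟩, h4⟩
      exact ⟨h4, h3⟩
    · rintro ⟨h4, h3⟩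
      exact ⟨⟨⟨by linarith, by linarith⟩, h3⟩, h4⟩)
  have hsymm : ∀ x ∈ S, -x ∈ S := by
    rintro x ⟨hx, hpx⟩
    exact ⟨⟨by linarith [hx.2], by linarith [hx.1]⟩, by rw [hp.iterate_neg k hx, hpx]⟩
  set T := {x ∈ S | id x ∈ Set.Ioc (0 : ℝ) n} with hT
  have hzero : (0 : ℝ) ∈ S := by
    refine ⟨by simp, by rw [hp.iterate_zero]; simp⟩
  have hST : S = ({0} ∪ T) ∪ (fun x => -x) '' T := by
    ext x
    constructor
    · intro hx
      rcases lt_trichotomy x 0 with h | h | h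
      · exact Or.inr ⟨-x, ⟨hsymm x hx, by simpa using h, by simpa using (hsymm x hx).1.2⟩, by simp⟩
      · exact Or.inl (Or.inl h)
      · exact Or.inl (Or.inr ⟨hx, h, hx.1.2⟩)
    · rintro ((rfl | hx) | ⟨y, hy, rfl⟩)
      · exact hzero
      · exact hx.1
      · exact hsymm y hy.1
  rw [hST, Set.encard_union_eq, Set.encard_union_eq, neg_injective.encard_image, hpos,
    Set.encard_singleton]
  · push_cast
    ring
  · rw [Set.disjoint_left]
    rintro x rfl ⟨-, h, -⟩
    exact lt_irrefl _ h
  · rw [Set.disjoint_left]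
    rintro _ hx ⟨y, ⟨-, hy, -⟩, rfl⟩
    simp only [id] at hy
    rcases hx with hx | ⟨-, hx, -⟩
    · simp at hx; linarith
    · simp at hx; linarith

/-- For `n ≥ 2`, the continuous odd map `p_n : [-n, n] → [-n, n]` has exactly `s_{n,k}`
solutions of `p_n^k(x) = -x` in `[-n, n]`. -/
theorem statement18 (n : ℕ) (hn : 2 ≤ n) (p : ℝ → ℝ)
    (hmaps : Set.MapsTo p (Set.Icc (-(n : ℝ)) (n : ℝ)) (Set.Icc (-(n : ℝ)) (n : ℝ)))
    (hcont : ContinuousOn p (Set.Icc (-(n : ℝ)) (n : ℝ)))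
    (hodd : ∀ x ∈ Set.Icc (-(n : ℝ)) (n : ℝ), p (-x) = - p x)
    (hp0 : p 0 = 0)
    (hpi : ∀ i : ℕ, 1 ≤ i → i ≤ n - 1 → p (i : ℝ) = (i : ℝ) + 1)
    (hpn : p (n : ℝ) = -1)
    (haff : ∀ j : ℤ, -(n : ℤ) ≤ j → j ≤ (n : ℤ) - 1 → AffOn p (j : ℝ) ((j : ℝ) + 1))
    (s : ℕ → ℤ)
    (hs1 : ∀ k : ℕ, 1 ≤ k → k ≤ n - 1 → s k = 1)
    (hs2 : ∀ k : ℕ, n ≤ k → k ≤ 2 * n - 1 → s k = 2 ^ (k - n) * (2 * (k : ℤ)) + 1)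
    (hsRec : ∀ k : ℕ, 2 * n ≤ k →
      s k = 3 * s (k - 1) - ∑ i ∈ Finset.Icc 2 (2 * n - 1), s (k - i))
    (k : ℕ) (hk : 0 < k) :
    {x ∈ Set.Icc (-(n : ℝ)) (n : ℝ) | p^[k] x = -x}.Finite ∧
      ({x ∈ Set.Icc (-(n : ℝ)) (n : ℝ) | p^[k] x = -x}.ncard : ℤ) = s k := by
  have hn1 : (n : ℝ) - 1 = (n - 1 : ℕ) := by
    rw [Nat.cast_sub (by omega)]; simp
  have hp : IsCellMap n p := by
    refine ⟨hmaps, hodd, ?_, ?_, ?_⟩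
    · intro x hx
      have h := haff 0 (by omega) (by omega) x (by simpa using hx)
      have h1 := hpi 1 le_rfl (by omega)
      norm_num at h h1
      rw [h, hp0, h1]
      ring
    · intro c hc hcn x hx
      have h := haff c (by omega) (by omega) x (by simpa using hx)
      have h1 := hpi c hc (by omega)
      have h2 := hpi (c + 1) (by omega) (by omega)
      push_cast at h h2
      rw [h, h1, h2]
      ring
    · intro x hx
      have h := haff ((n : ℤ) - 1) (by omega) (by omega) x (by push_cast; simpa using hx)
      have h1 := hpi (n - 1) (by omega) le_rfl
      rw [← hn1] at h1
      push_cast at h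
      rw [sub_add_cancel, h1, hpn] at h
      rw [h]
      ring
  have hcard := encard_eq_neg hn hp k
  refine ⟨Set.finite_of_encard_eq_coe hcard, ?_⟩
  rw [Set.ncard_def, hcard, ENat.toNat_natCast, eq_one_add_two_mul_diagCount hn s hs1 hs2 hsRec hk,
    diagCount]
  push_cast
  rfl
end

section
/- For every integer n ≥ 2 and every positive integer k, Φ₂(k, ψ_{s_n}) ≡ 0 (mod 2k), where ψ_{s_n}(k) = s_{n,k}. -/
open scoped Classical

/-- `Phi2 m ψ = ψ(m) - 1` if `m` is a power of 2, and otherwise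
`∑_{d ∣ m, d odd and squarefree} μ(d) · ψ(m/d)`. -/
noncomputable def Phi2 (m : ℕ) (ψ : ℕ → ℤ) : ℤ :=
  if ∃ i : ℕ, m = 2 ^ i then ψ m - 1
  else ∑ d ∈ m.divisors.filter (fun d => Odd d ∧ Squarefree d),
    (ArithmeticFunction.moebius d) * ψ (m / d)

open PowerSeries

/-- The logarithmic Euler derivative, `X` times the logarithmic derivative, of invertible power series. -/
noncomputable def eulerLog : ℤ⟦X⟧ˣ →* Multiplicative ℤ⟦X⟧ :=
  MonoidHom.mk' (fun u => Multiplicative.ofAdd (X * d⁄dX ℤ (u : ℤ⟦X⟧) * ((u⁻¹ : ℤ⟦X⟧ˣ) : ℤ⟦X⟧))) (by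
    intro u v
    rw [← ofAdd_add]
    congr 1
    have hu := u.mul_inv
    have hv := v.mul_inv
    simp only [Units.val_mul, mul_inv, Derivation.leibniz, smul_eq_mul]
    linear_combination (X * d⁄dX ℤ (v : ℤ⟦X⟧) * ((v⁻¹ : ℤ⟦X⟧ˣ) : ℤ⟦X⟧)) * hu +
      (X * d⁄dX ℤ (u : ℤ⟦X⟧) * ((u⁻¹ : ℤ⟦X⟧ˣ) : ℤ⟦X⟧)) * hv)

lemma mul_toAdd_eulerLog (u : ℤ⟦X⟧ˣ) :
    (u : ℤ⟦X⟧) * (eulerLog u).toAdd = X * d⁄dX ℤ (u : ℤ⟦X⟧) := by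
  have hu := u.mul_inv
  simp only [eulerLog, MonoidHom.mk'_apply, toAdd_ofAdd]
  linear_combination (X * d⁄dX ℤ (u : ℤ⟦X⟧)) * hu

/-- An invertible integral power series with the given constant coefficient `1`. -/
noncomputable def unitOfConstantCoeffEqOne (f : ℤ⟦X⟧) (hf : constantCoeff f = 1) : ℤ⟦X⟧ˣ :=
  (PowerSeries.isUnit_iff_constantCoeff.2 (hf ▸ isUnit_one)).unit

@[simp] lemma val_unitOfConstantCoeffEqOne (f : ℤ⟦X⟧) (hf : constantCoeff f = 1) :
    (unitOfConstantCoeffEqOne f hf : ℤ⟦X⟧) = f := rfl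

/-- The unit `(1 + X ^ N) / (1 - X ^ N)`. -/
noncomputable def cayleyUnit (N : ℕ) (hN : 0 < N) : ℤ⟦X⟧ˣ :=
  unitOfConstantCoeffEqOne (1 + X ^ N) (by simp [hN.ne']) /
    unitOfConstantCoeffEqOne (1 - X ^ N) (by simp [hN.ne'])

lemma cayleyUnit_mul (N : ℕ) (hN : 0 < N) :
    (cayleyUnit N hN : ℤ⟦X⟧) * (1 - X ^ N) = 1 + X ^ N := by
  have h : cayleyUnit N hN * unitOfConstantCoeffEqOne (1 - X ^ N) (by simp [hN.ne']) =
      unitOfConstantCoeffEqOne (1 + X ^ N) (by simp [hN.ne']) := div_mul_cancel _ _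
  simpa using congrArg Units.val h

lemma toAdd_eulerLog_cayleyUnit (N : ℕ) (hN : 0 < N) :
    (eulerLog (cayleyUnit N hN)).toAdd =
      PowerSeries.mk fun j => if N ∣ j ∧ Odd (j / N) then 2 * (N : ℤ) else 0 := by
  have hd : X * d⁄dX ℤ (X ^ N : ℤ⟦X⟧) = (N : ℤ⟦X⟧) * X ^ N := by
    obtain ⟨m, rfl⟩ := Nat.exists_eq_succ_of_ne_zero hN.ne'
    simp only [Derivation.leibniz_pow, derivative_X, Nat.succ_eq_add_one,
      Nat.add_sub_cancel, smul_eq_mul, nsmul_eq_mul]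
    ring
  have h1 := mul_toAdd_eulerLog (unitOfConstantCoeffEqOne (1 + X ^ N) (by simp [hN.ne']))
  have h2 := mul_toAdd_eulerLog (unitOfConstantCoeffEqOne (1 - X ^ N) (by simp [hN.ne']))
  simp only [val_unitOfConstantCoeffEqOne, map_add, map_sub, Derivation.map_one_eq_zero,
    zero_add, zero_sub, mul_neg, hd] at h1 h2
  have hne : (1 - X ^ (2 * N) : ℤ⟦X⟧) ≠ 0 := by
    intro h
    simpa [hN.ne'] using congrArg constantCoeff h
  refine mul_left_cancel₀ hne ?_
  have h3 : (1 - X ^ (2 * N) : ℤ⟦X⟧) * (eulerLog (cayleyUnit N hN)).toAdd =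
      C (2 * (N : ℤ)) * X ^ N := by
    rw [cayleyUnit, map_div, toAdd_div]
    simp only [map_mul, map_natCast, map_ofNat]
    linear_combination (1 - X ^ N) * h1 - (1 + X ^ N) * h2
  rw [h3]
  ext j
  rw [sub_mul, one_mul, map_sub, coeff_X_pow_mul', coeff_C_mul, coeff_X_pow]
  simp only [coeff_mk]
  rcases lt_or_ge j (2 * N) with hj | hj
  · rw [if_neg (not_le.2 hj), sub_zero]
    by_cases hjN : j = N
    · subst hjN
      simp [Nat.div_self hN]
    · rw [if_neg hjN, if_neg, mul_zero]
      rintro ⟨⟨q, rfl⟩, ho⟩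
      rw [Nat.mul_div_cancel_left _ hN] at ho
      have : q < 2 := by nlinarith
      obtain rfl : q = 1 := by rcases ho with ⟨r, rfl⟩; omega
      simp at hjN
  · obtain ⟨i, rfl⟩ := Nat.exists_eq_add_of_le hj
    have e : (2 * N + i) / N = i / N + 2 := by
      rw [add_comm, Nat.add_mul_div_right _ _ hN]
    have d : N ∣ 2 * N + i ↔ N ∣ i := Nat.dvd_add_right (Dvd.intro_left 2 rfl)
    rw [if_neg (by omega), if_pos hj, Nat.add_sub_cancel_left, e]
    simp [d, parity_simps]

lemma mul_congr_one_add {N : ℕ} (hN : 0 < N) {u v : ℤ⟦X⟧} {a b : ℤ}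
    (hu : 2 * X ^ (N + 1) ∣ u - (1 + 2 * (a : ℤ⟦X⟧) * X ^ N))
    (hv : 2 * X ^ (N + 1) ∣ v - (1 + 2 * (b : ℤ⟦X⟧) * X ^ N)) :
    2 * X ^ (N + 1) ∣ u * v - (1 + 2 * ((a + b : ℤ) : ℤ⟦X⟧) * X ^ N) := by
  obtain ⟨f, hf⟩ := hu
  obtain ⟨g, hg⟩ := hv
  obtain ⟨m, rfl⟩ := Nat.exists_eq_succ_of_ne_zero hN.ne'
  refine ⟨f * v + g * (1 + 2 * (a : ℤ⟦X⟧) * X ^ (m + 1)) + 2 * (a : ℤ⟦X⟧) * (b : ℤ⟦X⟧) * X ^ m, ?_⟩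
  push_cast
  simp only [Nat.succ_eq_add_one] at hf hg ⊢
  linear_combination v * hf + (1 + 2 * (a : ℤ⟦X⟧) * X ^ (m + 1)) * hg

lemma cayleyUnit_pow_congr (N : ℕ) (hN : 0 < N) (c : ℕ) :
    2 * X ^ (N + 1) ∣ ((cayleyUnit N hN ^ c : ℤ⟦X⟧ˣ) : ℤ⟦X⟧) -
      (1 + 2 * ((c : ℤ) : ℤ⟦X⟧) * X ^ N) := by
  induction c with
  | zero => simp
  | succ c ih =>
    rw [pow_succ (cayleyUnit N hN), Units.val_mul]
    have h : 2 * X ^ (N + 1) ∣ (cayleyUnit N hN : ℤ⟦X⟧) - (1 + 2 * ((1 : ℤ) : ℤ⟦X⟧) * X ^ N) := by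
      have h := cayleyUnit_mul N hN
      obtain ⟨m, rfl⟩ := Nat.exists_eq_succ_of_ne_zero hN.ne'
      simp only [Nat.succ_eq_add_one] at h ⊢
      refine (IsUnit.dvd_mul_right (u := 1 - X ^ (m + 1))
        (PowerSeries.isUnit_iff_constantCoeff.2 (by simp))).1 ⟨X ^ m, ?_⟩
      push_cast
      linear_combination h
    exact_mod_cast mul_congr_one_add hN ih h

lemma inv_congr_one_add {N : ℕ} (hN : 0 < N) {u : ℤ⟦X⟧ˣ} {a : ℤ}
    (hu : 2 * X ^ (N + 1) ∣ (u : ℤ⟦X⟧) - (1 + 2 * (a : ℤ⟦X⟧) * X ^ N)) :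
    2 * X ^ (N + 1) ∣ ((u⁻¹ : ℤ⟦X⟧ˣ) : ℤ⟦X⟧) - (1 + 2 * ((-a : ℤ) : ℤ⟦X⟧) * X ^ N) := by
  have h := mul_congr_one_add hN (v := 1 + 2 * ((-a : ℤ) : ℤ⟦X⟧) * X ^ N) (b := -a) hu (by simp)
  simp only [add_neg_cancel, Int.cast_zero, mul_zero, zero_mul, add_zero] at h
  obtain ⟨f, hf⟩ := h
  have hi := u.inv_mul
  refine ⟨-(↑u⁻¹ * f), ?_⟩
  linear_combination (-(↑u⁻¹ : ℤ⟦X⟧)) * hf + (1 + 2 * ((-a : ℤ) : ℤ⟦X⟧) * X ^ N) * hi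

lemma cayleyUnit_zpow_congr (N : ℕ) (hN : 0 < N) (c : ℤ) :
    2 * X ^ (N + 1) ∣ ((cayleyUnit N hN ^ c : ℤ⟦X⟧ˣ) : ℤ⟦X⟧) -
      (1 + 2 * (c : ℤ⟦X⟧) * X ^ N) := by
  obtain ⟨m, rfl | rfl⟩ := Int.eq_nat_or_neg c
  · simpa using cayleyUnit_pow_congr N hN m
  · have := inv_congr_one_add hN (cayleyUnit_pow_congr N hN m)
    rwa [zpow_neg, zpow_natCast]

lemma exists_cayleyUnit_zpow_mul_congr_one {N : ℕ} (hN : 0 < N) (u : ℤ⟦X⟧ˣ)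
    (hu : 2 * X ^ N ∣ (u : ℤ⟦X⟧) - 1) :
    ∃ c : ℤ, 2 * X ^ (N + 1) ∣ ((cayleyUnit N hN ^ c * u : ℤ⟦X⟧ˣ) : ℤ⟦X⟧) - 1 := by
  obtain ⟨f, hf⟩ := hu
  obtain ⟨g, hg⟩ : X ∣ f - ((constantCoeff f : ℤ) : ℤ⟦X⟧) := by
    rw [X_dvd_iff]; simp
  refine ⟨-constantCoeff f, ?_⟩
  have h := mul_congr_one_add hN (cayleyUnit_zpow_congr N hN (-constantCoeff f))
    (v := u) (b := constantCoeff f) ⟨g, by linear_combination hf + 2 * X ^ N * hg⟩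
  simpa using h

/-- The Möbius sum over odd squarefree divisors. -/
noncomputable def oddMoebiusSum (m : ℕ) (ψ : ℕ → ℤ) : ℤ :=
  ∑ d ∈ m.divisors.filter (fun d => Odd d ∧ Squarefree d),
    (ArithmeticFunction.moebius d) * ψ (m / d)

lemma oddMoebiusSum_add (m : ℕ) (φ ψ : ℕ → ℤ) :
    oddMoebiusSum m (fun j => φ j + ψ j) = oddMoebiusSum m φ + oddMoebiusSum m ψ := by
  simp [oddMoebiusSum, mul_add, Finset.sum_add_distrib]

lemma oddMoebiusSum_const_mul (m : ℕ) (c : ℤ) (ψ : ℕ → ℤ) :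
    oddMoebiusSum m (fun j => c * ψ j) = c * oddMoebiusSum m ψ := by
  simp [oddMoebiusSum, Finset.mul_sum, mul_left_comm]

lemma oddMoebiusSum_one {m : ℕ} (hm : m ≠ 0) (h2 : ¬ ∃ i : ℕ, m = 2 ^ i) :
    oddMoebiusSum m (fun _ => 1) = 0 := by
  obtain ⟨a, q, hq, rfl⟩ := Nat.exists_eq_two_pow_mul_odd hm
  have hq0 : q ≠ 0 := hq.pos.ne'
  have hq1 : q ≠ 1 := by
    rintro rfl
    exact h2 ⟨a, mul_one _⟩
  have h : ∑ d ∈ q.divisors, ArithmeticFunction.moebius d = 0 := by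
    rw [← ArithmeticFunction.coe_mul_zeta_apply, ArithmeticFunction.moebius_mul_coe_zeta,
      ArithmeticFunction.one_apply_ne hq1]
  simp only [oddMoebiusSum, mul_one]
  rw [← h]
  refine Finset.sum_subset_zero_on_sdiff ?_ ?_ (fun _ _ => rfl)
  · intro d hd
    simp only [Finset.mem_filter, Nat.mem_divisors] at hd ⊢
    exact ⟨(hd.2.1.coprime_two_right.pow_right a).dvd_of_dvd_mul_left hd.1.1, hq0⟩
  · intro d hd
    simp only [Finset.mem_sdiff, Finset.mem_filter, Nat.mem_divisors] at hd
    refine ArithmeticFunction.moebius_eq_zero_of_not_squarefree fun hs => hd.2 ?_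
    exact ⟨⟨hd.1.1.mul_left _, hm⟩, hq.of_dvd_nat hd.1.1, hs⟩

lemma dvd_oddMoebiusSum_indicator {k N : ℕ} (hk : 0 < k) (hN : 0 < N) :
    (2 * k : ℤ) ∣ oddMoebiusSum k fun j => if N ∣ j ∧ Odd (j / N) then 2 * (N : ℤ) else 0 := by
  by_cases h : N ∣ k ∧ Odd (k / N)
  · obtain ⟨⟨q, rfl⟩, hq⟩ := h
    rw [Nat.mul_div_cancel_left _ hN] at hq
    have hq0 : q ≠ 0 := hq.pos.ne'
    have e : oddMoebiusSum (N * q) (fun j => if N ∣ j ∧ Odd (j / N) then 2 * (N : ℤ) else 0) =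
        2 * N * oddMoebiusSum q (fun _ => 1) := by
      simp only [oddMoebiusSum, mul_one, Finset.mul_sum]
      symm
      refine Finset.sum_subset_zero_on_sdiff ?_ ?_ ?_
      · intro d hd
        simp only [Finset.mem_filter, Nat.mem_divisors] at hd ⊢
        exact ⟨⟨hd.1.1.mul_left _, hk.ne'⟩, hd.2⟩
      · intro d hd
        simp only [Finset.mem_sdiff, Finset.mem_filter, Nat.mem_divisors] at hd
        rw [if_neg, mul_zero]
        rintro ⟨h1, -⟩
        refine hd.2 ⟨⟨?_, hq0⟩, hd.1.2⟩
        rw [Nat.dvd_div_iff_mul_dvd hd.1.1.1, mul_comm] at h1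
        exact Nat.dvd_of_mul_dvd_mul_left hN h1
      · intro d hd
        simp only [Finset.mem_filter, Nat.mem_divisors] at hd
        rw [if_pos, mul_comm]
        rw [Nat.mul_div_assoc _ hd.1.1, Nat.mul_div_cancel_left _ hN]
        exact ⟨dvd_mul_right _ _, hq.of_dvd_nat (Nat.div_dvd_of_dvd hd.1.1)⟩
    rw [e]
    by_cases hq1 : q = 1
    · subst hq1; simp
    · rw [oddMoebiusSum_one hq0, mul_zero]
      · exact dvd_zero _
      · rintro ⟨i, rfl⟩
        rcases i with _ | i
        · simp at hq1
        · exact (Nat.not_odd_iff_even.2 (by simp [parity_simps])) hq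
  · rw [oddMoebiusSum, Finset.sum_eq_zero]
    · exact dvd_zero _
    · intro d hd
      simp only [Finset.mem_filter, Nat.mem_divisors] at hd
      rw [if_neg, mul_zero]
      rintro ⟨h1, h2⟩
      obtain ⟨⟨⟨e, rfl⟩, -⟩, hdo, -⟩ := hd
      rw [Nat.mul_div_cancel_left _ hdo.pos] at h1 h2
      refine h ⟨h1.mul_left _, ?_⟩
      rw [Nat.mul_div_assoc _ h1]
      exact hdo.mul h2

lemma dvd_oddMoebiusSum_eulerLog {k N : ℕ} (hk : 0 < k) (hN : 0 < N) (hNk : N ≤ k + 1)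
    (u : ℤ⟦X⟧ˣ) (hu : 2 * X ^ N ∣ (u : ℤ⟦X⟧) - 1) :
    (2 * k : ℤ) ∣ oddMoebiusSum k fun j => coeff j (eulerLog u).toAdd := by
  induction hNk using Nat.decreasingInduction generalizing u with
  | self =>
    obtain ⟨f, hf⟩ := hu
    have hX : X ^ (k + 1) ∣ (eulerLog u).toAdd := by
      have hd : X ^ (k + 1) ∣ X * d⁄dX ℤ (u : ℤ⟦X⟧) := by
        rw [sub_eq_iff_eq_add.1 hf]
        simp only [map_add, Derivation.leibniz, smul_eq_mul, Derivation.leibniz_pow,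
          Derivation.map_one_eq_zero, derivative_X]
        refine ⟨2 * (X * d⁄dX ℤ f) + X * f * d⁄dX ℤ (2 : ℤ⟦X⟧) + 2 * ((k + 1 : ℕ) : ℤ⟦X⟧) * f, ?_⟩
        simp only [nsmul_eq_mul, Nat.add_sub_cancel]
        ring
      rw [← mul_toAdd_eulerLog] at hd
      exact (IsUnit.dvd_mul_left u.isUnit).1 hd
    rw [X_pow_dvd_iff] at hX
    rw [oddMoebiusSum, Finset.sum_eq_zero]
    · exact dvd_zero _
    · intro d _
      rw [hX _ (Nat.lt_succ_of_le (Nat.div_le_self _ _)), mul_zero]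
  | of_succ N hNk ih =>
    obtain ⟨c, hc⟩ := exists_cayleyUnit_zpow_mul_congr_one hN u hu
    have h := ih N.succ_pos _ hc
    have e : (fun j => coeff j (eulerLog (cayleyUnit N hN ^ c * u)).toAdd) = fun j =>
        c * (if N ∣ j ∧ Odd (j / N) then 2 * (N : ℤ) else 0) + coeff j (eulerLog u).toAdd := by
      ext j
      rw [map_mul, map_zpow, toAdd_mul, toAdd_zpow, toAdd_eulerLog_cayleyUnit, map_add, map_zsmul, coeff_mk,
        smul_eq_mul]
    rw [e, oddMoebiusSum_add, oddMoebiusSum_const_mul] at h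
    exact (dvd_add_right ((dvd_oddMoebiusSum_indicator hk hN).mul_left c)).1 h

/-- `s k - 1`, extended by `0` at `0`, is given by the linear recurrence with characteristic
polynomial `(x ^ n - 2 x ^ (n - 1)) ^ 2 - 1`. -/
lemma mul_mk_sub_one (n : ℕ) (hn : 2 ≤ n) (s : ℕ → ℤ)
    (hs1 : ∀ k : ℕ, 1 ≤ k → k ≤ n - 1 → s k = 1)
    (hs2 : ∀ k : ℕ, n ≤ k → k ≤ 2 * n - 1 → s k = 2 ^ (k - n) * (2 * (k : ℤ)) + 1)
    (hsRec : ∀ k : ℕ, 2 * n ≤ k →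
      s k = 3 * s (k - 1) - ∑ i ∈ Finset.Icc 2 (2 * n - 1), s (k - i)) :
    ((1 - 2 * X) ^ 2 - X ^ (2 * n) : ℤ⟦X⟧) *
        PowerSeries.mk (fun k => if k = 0 then 0 else s k - 1) =
      2 * (n : ℤ⟦X⟧) * X ^ n - 4 * ((n : ℤ⟦X⟧) - 1) * X ^ (n + 1) := by
  set t : ℕ → ℤ := fun k => if k = 0 then 0 else s k - 1 with ht
  have ht0 : ∀ k < n, t k = 0 := by
    intro k hk
    rcases Nat.eq_zero_or_pos k with rfl | h0
    · simp [ht]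
    · simp [ht, hs1 k h0 (by omega)]
  have ht1 : ∀ i < n, t (n + i) = 2 ^ i * (2 * (n + i)) := by
    intro i hi
    have := hs2 (n + i) (by omega) (by omega)
    rw [Nat.add_sub_cancel_left] at this
    simp only [ht]
    rw [if_neg (by omega), this]
    push_cast
    ring
  have hst : ∀ k, 0 < k → s k = t k + 1 := by
    intro k hk
    simp [ht, hk.ne']
  have hrec : ∀ i, s (2 * n + i) =
      3 * s (2 * n + i - 1) - ∑ j ∈ Finset.range (2 * n - 2), s (i + 1 + j) := by
    intro i
    rw [hsRec _ (Nat.le_add_right _ _)]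
    congr 1
    refine Finset.sum_bij' (fun j _ => 2 * n - 1 - j) (fun j _ => 2 * n - 1 - j) ?_ ?_ ?_ ?_ ?_
    all_goals intro j hj
    all_goals simp only [Finset.mem_Icc, Finset.mem_range] at hj ⊢
    any_goals omega
    congr 1
    omega
  have hsum : ∀ m < n, ∑ j ∈ Finset.range (n - 1 + m), s (1 + j) =
      (n - 1 : ℤ) + m + 2 ^ m * (2 * (n + m - 2)) - 2 * (n - 2) := by
    intro m hm
    induction m with
    | zero =>
      rw [Finset.sum_congr rfl (g := fun _ => (1 : ℤ))]
      · simp [Nat.cast_sub (by omega : 1 ≤ n)]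
      · intro j hj
        rw [Finset.mem_range] at hj
        exact hs1 _ (by omega) (by omega)
    | succ m ih =>
      rw [← add_assoc, Finset.sum_range_succ, ih (by omega),
        show 1 + (n - 1 + m) = n + m by omega, hst _ (by omega), ht1 m (by omega)]
      push_cast
      ring
  have hfirst : t (2 * n) = 4 * t (2 * n - 1) - 4 * t (2 * n - 2) := by
    obtain ⟨r, rfl⟩ := Nat.exists_eq_add_of_le hn
    have h := hrec 0
    have h' := hsum (1 + r) (by omega)
    rw [show 2 + r - 1 + (1 + r) = 2 * (2 + r) - 2 by omega] at h'
    simp only [zero_add, add_zero] at h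
    rw [h', hst _ (by omega), hst _ (by omega), show 2 * (2 + r) - 1 = 2 + r + (1 + r) by omega,
      ht1 _ (by omega)] at h
    rw [show 2 * (2 + r) - 1 = 2 + r + (1 + r) by omega, ht1 _ (by omega),
      show 2 * (2 + r) - 2 = 2 + r + r by omega, ht1 _ (by omega)]
    push_cast at h ⊢
    rw [pow_add] at h ⊢
    linear_combination h
  have hlater : ∀ i, t (2 * n + (i + 1)) =
      4 * t (2 * n + i) - 4 * t (2 * n + i - 1) + t (i + 1) := by
    intro i
    have h1 := hrec (i + 1)
    have h2 := hrec i
    obtain ⟨r, hr⟩ : ∃ r, 2 * n - 2 = r + 1 := ⟨2 * n - 3, by omega⟩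
    rw [hr, Finset.sum_range_succ] at h1
    rw [hr, Finset.sum_range_succ'] at h2
    rw [Finset.sum_congr rfl (g := fun j => s (i + 1 + (j + 1)))
      (fun j _ => by congr 1; omega)] at h1
    rw [show i + 1 + 1 + r = 2 * n + i - 1 by omega,
      show 2 * n + (i + 1) - 1 = 2 * n + i by omega, hst (2 * n + (i + 1)) (by omega)] at h1
    rw [hst (2 * n + i) (by omega)] at h1 h2
    rw [hst (2 * n + i - 1) (by omega)] at h1 h2
    rw [add_zero, hst (i + 1) (by omega)] at h2
    linear_combination h1 - h2
  have e : ((1 - 2 * X) ^ 2 - X ^ (2 * n) : ℤ⟦X⟧) * PowerSeries.mk t =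
      PowerSeries.mk t - C 4 * (X ^ 1 * PowerSeries.mk t) + C 4 * (X ^ 2 * PowerSeries.mk t) -
        X ^ (2 * n) * PowerSeries.mk t := by
    rw [map_ofNat]
    ring
  have e' : (2 * (n : ℤ⟦X⟧) * X ^ n - 4 * ((n : ℤ⟦X⟧) - 1) * X ^ (n + 1) : ℤ⟦X⟧) =
      C (2 * n : ℤ) * X ^ n - C (4 * (n - 1) : ℤ) * X ^ (n + 1) := by simp
  rw [e, e']
  ext k
  simp only [map_sub, map_add, coeff_C_mul, coeff_X_pow_mul', coeff_X_pow, coeff_mk]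
  rcases lt_or_ge k n with hk | hk
  · simp [ht0 k hk, ht0 (k - 1) (by omega), ht0 (k - 2) (by omega), show k ≠ n by omega,
      show k ≠ n + 1 by omega, show ¬ 2 * n ≤ k by omega]
  obtain ⟨i, rfl⟩ := Nat.exists_eq_add_of_le hk
  rcases lt_or_ge i n with hi | hi
  · rw [if_pos (by omega), if_pos (by omega), if_neg (by omega : ¬ 2 * n ≤ n + i), ht1 i hi]
    rcases i with _ | _ | i
    · simp [ht0 (n - 1) (by omega), ht0 (n - 2) (by omega)]
    · have := ht1 0 (by omega)
      simp only [add_zero] at this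
      simp [this, ht0 (n - 1) (by omega), show n + 1 - 2 = n - 1 by omega]
      ring
    · rw [show n + (i + 1 + 1) - 1 = n + (i + 1) by omega,
        show n + (i + 1 + 1) - 2 = n + i by omega, ht1 _ (by omega), ht1 _ (by omega),
        if_neg (by omega), if_neg (by omega)]
      push_cast
      ring
  · rw [if_pos (by omega), if_pos (by omega), if_pos (by omega), if_neg (by omega),
      if_neg (by omega)]
    obtain ⟨j, rfl⟩ := Nat.exists_eq_add_of_le hi
    rw [show n + (n + j) = 2 * n + j by omega]
    rcases j with _ | j
    · rw [add_zero, hfirst, Nat.sub_self, ht0 0 (by omega)]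
      ring
    · rw [hlater, show 2 * n + (j + 1) - 1 = 2 * n + j by omega,
        show 2 * n + (j + 1) - 2 = 2 * n + j - 1 by omega, Nat.add_sub_cancel_left]
      ring

lemma exists_unit_toAdd_eulerLog_eq {n : ℕ} (hn : 2 ≤ n) (D : ℤ⟦X⟧)
    (hD : ((1 - 2 * X) ^ 2 - X ^ (2 * n) : ℤ⟦X⟧) * D =
      2 * (n : ℤ⟦X⟧) * X ^ n - 4 * ((n : ℤ⟦X⟧) - 1) * X ^ (n + 1)) :
    ∃ u : ℤ⟦X⟧ˣ, 2 * X ^ 1 ∣ (u : ℤ⟦X⟧) - 1 ∧ (eulerLog u).toAdd = D := by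
  obtain ⟨m, rfl⟩ := Nat.exists_eq_add_of_le' (show 1 ≤ n by omega)
  let p := unitOfConstantCoeffEqOne (1 - 2 * X + X ^ (m + 1)) (by simp)
  let q := unitOfConstantCoeffEqOne (1 - 2 * X - X ^ (m + 1)) (by simp)
  have hp : (p : ℤ⟦X⟧) = 1 - 2 * X + X ^ (m + 1) := rfl
  have hq : (q : ℤ⟦X⟧) = 1 - 2 * X - X ^ (m + 1) := rfl
  have hqi := q.mul_inv
  refine ⟨p / q, ⟨X ^ m * ((q⁻¹ : ℤ⟦X⟧ˣ) : ℤ⟦X⟧), ?_⟩, ?_⟩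
  · rw [div_eq_mul_inv, Units.val_mul, hp]
    rw [hq] at hqi
    linear_combination hqi
  · have h1 := mul_toAdd_eulerLog p
    have h2 := mul_toAdd_eulerLog q
    have hd2 : d⁄dX ℤ (2 : ℤ⟦X⟧) = 0 := by
      exact_mod_cast (d⁄dX ℤ).map_natCast 2
    rw [hp] at h1
    rw [hq] at h2
    simp only [map_add, map_sub, Derivation.leibniz, smul_eq_mul, Derivation.leibniz_pow,
      Derivation.map_one_eq_zero, derivative_X, hd2, nsmul_eq_mul, Nat.add_sub_cancel] at h1 h2
    have hne : ((1 - 2 * X) ^ 2 - X ^ (2 * (m + 1)) : ℤ⟦X⟧) ≠ 0 := by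
      intro h
      simpa using congrArg (constantCoeff (R := ℤ)) h
    refine mul_left_cancel₀ hne ?_
    rw [hD, map_div, toAdd_div]
    push_cast at h1 h2 ⊢
    linear_combination (1 - 2 * X - X ^ (m + 1)) * h1 - (1 - 2 * X + X ^ (m + 1)) * h2

lemma oddMoebiusSum_two_pow (i : ℕ) (ψ : ℕ → ℤ) : oddMoebiusSum (2 ^ i) ψ = ψ (2 ^ i) := by
  have h : (2 ^ i).divisors.filter (fun d => Odd d ∧ Squarefree d) = {1} := by
    ext d
    simp only [Finset.mem_filter, Finset.mem_singleton, Nat.mem_divisors]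
    constructor
    · rintro ⟨⟨h, -⟩, ho, -⟩
      exact Nat.Coprime.eq_one_of_dvd (ho.coprime_two_right.pow_right i) h
    · rintro rfl
      simp
  simp [oddMoebiusSum, h]

/-- For `n ≥ 2` and the sequence `s_{n,k}`, `Φ₂(k, s_n) ≡ 0 (mod 2k)`. -/
theorem statement19 (n : ℕ) (hn : 2 ≤ n) (s : ℕ → ℤ)
    (hs1 : ∀ k : ℕ, 1 ≤ k → k ≤ n - 1 → s k = 1)
    (hs2 : ∀ k : ℕ, n ≤ k → k ≤ 2 * n - 1 → s k = 2 ^ (k - n) * (2 * (k : ℤ)) + 1)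
    (hsRec : ∀ k : ℕ, 2 * n ≤ k →
      s k = 3 * s (k - 1) - ∑ i ∈ Finset.Icc 2 (2 * n - 1), s (k - i))
    (k : ℕ) (hk : 0 < k) :
    (2 * k : ℤ) ∣ Phi2 k s := by
  obtain ⟨u, hu, hD⟩ :=
    exists_unit_toAdd_eulerLog_eq hn _ (mul_mk_sub_one n hn s hs1 hs2 hsRec)
  have h := dvd_oddMoebiusSum_eulerLog hk one_pos (by omega) u hu
  simp only [hD, coeff_mk] at h
  rw [Phi2]
  split_ifs with h2
  · obtain ⟨i, rfl⟩ := h2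
    rw [oddMoebiusSum_two_pow, if_neg hk.ne'] at h
    exact h
  · have e : oddMoebiusSum k s =
        oddMoebiusSum k (fun j => if j = 0 then 0 else s j - 1) + oddMoebiusSum k fun _ => 1 := by
      rw [← oddMoebiusSum_add]
      refine Finset.sum_congr rfl fun d hd => ?_
      simp only [Finset.mem_filter, Nat.mem_divisors] at hd
      have : k / d ≠ 0 := (Nat.div_pos (Nat.le_of_dvd hk hd.1.1) hd.2.1.pos).ne'
      simp [this]
    rw [oddMoebiusSum_one hk.ne' h2, add_zero] at e
    rw [← e] at h
    exact h
end
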